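/- Let n ≥ 2, q_0 ≥ 0, and let P: [q_0,∞) → ℝ^n be an (n,0)-system. Then there exists a unit vector u ∈ ℝ^n such that ‖P(q) − L_u(q)‖_∞ ≤ 3n²(n+9) for all q ≥ q_0. -/

import Mathlib

open scoped RealInnerProductSpace Pointwise
open Finset

noncomputable section

/-- The `j`-th successive minimum of `C` with respect to the lattice `L`. -/
def minkMin {V : Type*} [AddCommGroup V] [Module ℝ V]
    (L : Set V) (C : Set V) (j : ℕ) : ℝ :=
  sInf {r : ℝ | 0 < r ∧ ∃ t : Finset V, ↑t ⊆ L ∩ (r • C) ∧ j ≤ t.card ∧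
    LinearIndependent ℝ (fun v : t => (v : V))}

/-- The lattice `ℤⁿ ⊆ ℝⁿ`. -/
def intLattice (n : ℕ) : Set (EuclideanSpace ℝ (Fin n)) := {x | ∀ j, ∃ m : ℤ, x j = m}

/-- The convex body `C_u(Q) = {x : ‖x‖ ≤ 1, |x·u| ≤ Q⁻¹}`. -/
def bodyC {n : ℕ} (u : EuclideanSpace ℝ (Fin n)) (Q : ℝ) :
    Set (EuclideanSpace ℝ (Fin n)) := {x | ‖x‖ ≤ 1 ∧ |⟪x, u⟫| ≤ Q⁻¹}

/-- The partial sum `M_j = P_1 + ⋯ + P_j`. -/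
def Msum {n : ℕ} (P : ℝ → Fin n → ℝ) (j : ℕ) (q : ℝ) : ℝ :=
  ∑ i ∈ Finset.univ.filter (fun i : Fin n => (i : ℕ) < j), P q i

/-- `f` is piecewise linear with slopes `0` and `1` on `[q₀,∞)`. -/
def Slope01On (f : ℝ → ℝ) (q₀ : ℝ) : Prop :=
  (∀ q, q₀ ≤ q → HasDerivWithinAt f 0 (Set.Ici q) q ∨ HasDerivWithinAt f 1 (Set.Ici q) q) ∧
  (∀ q, q₀ < q → HasDerivWithinAt f 0 (Set.Icc q₀ q) q ∨ HasDerivWithinAt f 1 (Set.Icc q₀ q) q)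

/-- `f` changes slope from `1` to `0` at `q` (within `[q₀,∞)`). -/
def ChangesSlopeOn (f : ℝ → ℝ) (q₀ q : ℝ) : Prop :=
  HasDerivWithinAt f 1 (Set.Icc q₀ q) q ∧ HasDerivWithinAt f 0 (Set.Ici q) q

/-- An `(n,γ)`-system on `[q₀,∞)` (Schmidt–Summerer, Definition 2.6). -/
def IsNSystem (n : ℕ) (γ q₀ : ℝ) (P : ℝ → Fin n → ℝ) : Prop :=
  (∀ q, q₀ ≤ q → ∀ j : Fin n, -γ ≤ P q j) ∧
  (∀ q, q₀ ≤ q → ∀ j : Fin n, ∀ h : (j : ℕ) + 1 < n, P q j ≤ P q ⟨(j : ℕ) + 1, h⟩ + γ) ∧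
  (∀ j : Fin n, ∀ q₁ q₂, q₀ ≤ q₁ → q₁ ≤ q₂ → P q₁ j ≤ P q₂ j + γ) ∧
  (∀ j, j ≤ n → ContinuousOn (Msum P j) (Set.Ici q₀) ∧ Slope01On (Msum P j) q₀) ∧
  (∀ q, q₀ ≤ q → Msum P n q = q) ∧
  (∀ j : ℕ, ∀ hj1 : 1 ≤ j, ∀ hj : j < n, ∀ q, q₀ < q →
    ChangesSlopeOn (Msum P j) q₀ q →
      P q ⟨j, hj⟩ ≤ P q ⟨j - 1, by omega⟩ + γ)

/-- The determinant in the standard coordinates of `ℝⁿ`. -/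
def coordDet (n : ℕ) : EuclideanSpace ℝ (Fin n) [⋀^Fin n]→ₗ[ℝ] ℝ :=
  (EuclideanSpace.basisFun (Fin n) ℝ).toBasis.det

lemma coordDet_apply {n : ℕ} (x : Fin n → EuclideanSpace ℝ (Fin n)) :
    coordDet n x = Matrix.det (Matrix.of fun i j => x j i) := by
  rw [coordDet, Module.Basis.det_apply]
  congr 1

/-- Hadamard's inequality. -/
lemma abs_coordDet_le {n : ℕ} (x : Fin n → EuclideanSpace ℝ (Fin n)) :
    |coordDet n x| ≤ ∏ i, ‖x i‖ := by
  have : Fact (Module.finrank ℝ (EuclideanSpace ℝ (Fin n)) = n) := ⟨by simp⟩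
  let o := (EuclideanSpace.basisFun (Fin n) ℝ).toBasis.orientation
  rw [coordDet, ← o.volumeForm_robust' (EuclideanSpace.basisFun (Fin n) ℝ)]
  exact o.abs_volumeForm_apply_le x

lemma exists_int_coordDet_eq {n : ℕ} {x : Fin n → EuclideanSpace ℝ (Fin n)}
    (hx : ∀ i, x i ∈ intLattice n) : ∃ m : ℤ, coordDet n x = m := by
  choose f hf using hx
  refine ⟨Matrix.det (Matrix.of fun i j => f j i), ?_⟩
  rw [coordDet_apply]
  have : (Matrix.of fun i j => x j i) = (Matrix.of fun i j => f j i).map (Int.castRingHom ℝ) := by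
    ext i j; simp [hf]
  rw [this, ← RingHom.mapMatrix_apply, ← RingHom.map_det]; simp

/-- Basis attached to a family with nonzero determinant. -/
lemma exists_basis_of_coordDet_ne_zero {n : ℕ} {x : Fin n → EuclideanSpace ℝ (Fin n)}
    (hx : coordDet n x ≠ 0) :
    ∃ b : Module.Basis (Fin n) ℝ (EuclideanSpace ℝ (Fin n)), ⇑b = x := by
  have h := ((EuclideanSpace.basisFun (Fin n) ℝ).toBasis.is_basis_iff_det (v := x)).2
    (isUnit_iff_ne_zero.2 hx)
  exact ⟨Module.Basis.mk h.1 h.2.ge, Module.Basis.coe_mk _ _⟩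

lemma coordDet_update_sum {n : ℕ} (x : Fin n → EuclideanSpace ℝ (Fin n)) (i : Fin n)
    (a : Fin n → ℝ) :
    coordDet n (Function.update x i (∑ k, a k • x k)) = a i * coordDet n x := by
  rw [AlternatingMap.map_update_sum]
  rw [Finset.sum_eq_single i]
  · rw [AlternatingMap.map_update_smul, Function.update_eq_self]; rfl
  · intro k _ hk
    rw [AlternatingMap.map_update_smul, AlternatingMap.map_update_self _ _ hk.symm, smul_zero]
  · simp

lemma abs_coordDet_le_sum {n : ℕ} {x : Fin n → EuclideanSpace ℝ (Fin n)}
    {u : EuclideanSpace ℝ (Fin n)} (hu : ‖u‖ = 1) (hx : coordDet n x ≠ 0) :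
    |coordDet n x| ≤ ∑ i, |⟪x i, u⟫| * ∏ k ∈ univ.erase i, ‖x k‖ := by
  obtain ⟨b, rfl⟩ := exists_basis_of_coordDet_ne_zero hx
  have h1 : (1 : ℝ) = ∑ i, b.repr u i * ⟪b i, u⟫ := by
    have : ⟪u, u⟫ = (1 : ℝ) := by rw [real_inner_self_eq_norm_sq, hu]; norm_num
    rw [← this]
    conv_lhs => rw [← b.sum_repr u]
    conv_lhs => arg 2; rw [b.sum_repr u]
    rw [inner_sum]
    exact Finset.sum_congr rfl fun i _ => by rw [real_inner_smul_right, real_inner_comm]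
  have h2 : coordDet n b = ∑ i, ⟪b i, u⟫ * coordDet n (Function.update b i u) := by
    have : ∀ i, coordDet n (Function.update b i u) = b.repr u i * coordDet n b := by
      intro i
      conv_lhs => rw [← b.sum_repr u]
      exact coordDet_update_sum _ _ _
    simp_rw [this]
    calc coordDet n b = 1 * coordDet n b := by ring
      _ = _ := by rw [h1, Finset.sum_mul]; exact Finset.sum_congr rfl fun i _ => by ring
  rw [h2]
  refine (Finset.abs_sum_le_sum_abs _ _).trans (Finset.sum_le_sum fun i _ => ?_)
  rw [abs_mul]
  refine mul_le_mul_of_nonneg_left ((abs_coordDet_le _).trans ?_) (abs_nonneg _)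
  rw [← Finset.mul_prod_erase _ _ (mem_univ i), Function.update_self, hu, one_mul]
  refine le_of_eq (Finset.prod_congr rfl fun k hk => ?_)
  rw [Function.update_of_ne (Finset.ne_of_mem_erase hk)]

lemma mem_smul_bodyC {n : ℕ} {u x : EuclideanSpace ℝ (Fin n)} {r q : ℝ} (hr : 0 < r) :
    x ∈ r • bodyC u (Real.exp q) ↔ ‖x‖ ≤ r ∧ |⟪x, u⟫| ≤ r * Real.exp (-q) := by
  rw [Set.mem_smul_set_iff_inv_smul_mem₀ hr.ne', bodyC, Set.mem_ofPred_eq, norm_smul,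
    real_inner_smul_left, abs_mul, Real.norm_eq_abs, abs_of_pos (inv_pos.2 hr), ← Real.exp_neg,
    inv_mul_le_iff₀ hr, inv_mul_le_iff₀ hr, mul_one]

/-- A lower bound for the length of any vector that completes part of a basis. -/
lemma exp_le_of_exchange {n : ℕ} {u : EuclideanSpace ℝ (Fin n)} (hu : ‖u‖ = 1)
    {q c r : ℝ} {p : Fin n → ℝ} (hsum : ∑ i, p i = q)
    {z : Fin n → EuclideanSpace ℝ (Fin n)} (hz : ∀ i, z i ∈ intLattice n)
    (hz1 : ∀ i, ‖z i‖ ≤ Real.exp (p i + c))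
    (hz2 : ∀ i, |⟪z i, u⟫| ≤ Real.exp (p i + c - q))
    {x : EuclideanSpace ℝ (Fin n)} (hx : x ∈ intLattice n) (hx1 : ‖x‖ ≤ r)
    (hx2 : |⟪x, u⟫| ≤ r * Real.exp (-q)) (i₀ : Fin n)
    (hdet : coordDet n (Function.update z i₀ x) ≠ 0) :
    1 ≤ n * r * Real.exp ((n - 1) * c - p i₀) := by
  set y := Function.update z i₀ x with hy
  let B : Fin n → ℝ := Function.update (fun i => Real.exp (p i + c)) i₀ r
  have hyint : ∀ i, y i ∈ intLattice n := by
    intro i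
    rcases eq_or_ne i i₀ with rfl | h
    · simpa [hy] using hx
    · simpa [hy, h] using hz i
  have hB : ∀ i, ‖y i‖ ≤ B i := by
    intro i
    rcases eq_or_ne i i₀ with rfl | h
    · simpa [hy, B] using hx1
    · simpa [hy, h, B] using hz1 i
  have hB' : ∀ i, |⟪y i, u⟫| ≤ B i * Real.exp (-q) := by
    intro i
    rcases eq_or_ne i i₀ with rfl | h
    · simpa [hy, B] using hx2
    · simpa [hy, h, B, ← Real.exp_add, sub_eq_add_neg] using hz2 i
  have hBpos : ∀ i, 0 ≤ B i := fun i => (norm_nonneg _).trans (hB i)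
  have hone : 1 ≤ |coordDet n y| := by
    obtain ⟨m, hm⟩ := exists_int_coordDet_eq hyint
    rw [hm] at hdet ⊢
    have : m ≠ 0 := by rintro rfl; simp at hdet
    exact_mod_cast Int.one_le_abs this
  have hprod : ∏ i, B i = r * Real.exp (q - p i₀ + (n - 1) * c) := by
    rw [← Finset.mul_prod_erase _ _ (mem_univ i₀)]
    congr 1
    · simp [B]
    rw [Finset.prod_congr rfl (g := fun i => Real.exp (p i + c))
      (fun i hi => by simp [B, Finset.ne_of_mem_erase hi]), ← Real.exp_sum]
    congr 1
    have h1 := Finset.add_sum_erase univ (fun i => p i + c) (mem_univ i₀)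
    have h2 : ∑ i, (p i + c) = q + n * c := by
      rw [Finset.sum_add_distrib, hsum]; simp
    simp only [h2] at h1
    linarith
  calc (1 : ℝ) ≤ ∑ i, |⟪y i, u⟫| * ∏ k ∈ univ.erase i, ‖y k‖ :=
        hone.trans (abs_coordDet_le_sum hu hdet)
    _ ≤ ∑ i : Fin n, Real.exp (-q) * ∏ k, B k := by
        refine Finset.sum_le_sum fun i _ => ?_
        rw [← Finset.mul_prod_erase _ _ (mem_univ i), ← mul_assoc, mul_comm (Real.exp _)]
        exact mul_le_mul (hB' i) (Finset.prod_le_prod (fun _ _ => norm_nonneg _) fun k _ => hB k)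
          (Finset.prod_nonneg fun _ _ => norm_nonneg _)
          (mul_nonneg (hBpos i) (Real.exp_pos _).le)
    _ = n * r * Real.exp ((n - 1) * c - p i₀) := by
        rw [Finset.sum_const, card_univ, Fintype.card_fin, nsmul_eq_mul, hprod,
          show ((n : ℝ) - 1) * c - p i₀ = -q + (q - p i₀ + (n - 1) * c) by ring, Real.exp_add (-q)]
        ring

/-- Integer points realizing the profile `p` up to `c` control the successive minima. -/
theorem abs_sub_log_minkMin_le {n : ℕ} (hn : 2 ≤ n) {u : EuclideanSpace ℝ (Fin n)}
    (hu : ‖u‖ = 1) {q c : ℝ} (hc : 0 ≤ c) {p : Fin n → ℝ} (hp : Monotone p)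
    (hsum : ∑ i, p i = q)
    {z : Fin n → EuclideanSpace ℝ (Fin n)} (hz : ∀ i, z i ∈ intLattice n)
    (hdet : coordDet n z ≠ 0)
    (hz1 : ∀ i, ‖z i‖ ≤ Real.exp (p i + c))
    (hz2 : ∀ i, |⟪z i, u⟫| ≤ Real.exp (p i + c - q)) (j : Fin n) :
    |p j - Real.log (minkMin (intLattice n) (bodyC u (Real.exp q)) ((j : ℕ) + 1))|
      ≤ (n - 1) * c + Real.log n := by
  obtain ⟨b, rfl⟩ := exists_basis_of_coordDet_ne_zero hdet
  have hn0 : (0 : ℝ) < n := by positivity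
  have hn2 : (2 : ℝ) ≤ n := by exact_mod_cast hn
  have hlogn : 0 ≤ Real.log n := Real.log_nonneg (by linarith)
  set S := {r : ℝ | 0 < r ∧ ∃ t : Finset (EuclideanSpace ℝ (Fin n)),
    ↑t ⊆ intLattice n ∩ (r • bodyC u (Real.exp q)) ∧ (j : ℕ) + 1 ≤ t.card ∧
    LinearIndependent ℝ (fun v : t => (v : EuclideanSpace ℝ (Fin n)))} with hS
  have hmem : Real.exp (p j + c) ∈ S := by
    refine ⟨Real.exp_pos _, (Finset.Iic j).image b, ?_, ?_, ?_⟩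
    · intro x hx
      simp only [Finset.coe_image, Set.mem_image, Finset.mem_coe, Finset.mem_Iic] at hx
      obtain ⟨i, hi, rfl⟩ := hx
      refine ⟨hz i, (mem_smul_bodyC (Real.exp_pos _)).2 ⟨(hz1 i).trans ?_, (hz2 i).trans ?_⟩⟩
      · exact Real.exp_le_exp.2 (by linarith [hp hi])
      · rw [← Real.exp_add]; exact Real.exp_le_exp.2 (by linarith [hp hi])
    · rw [Finset.card_image_of_injective _ b.injective]; simp
    · have := b.linearIndependent.linearIndepOn_id
      exact this.mono (fun x hx => by
        simp only [Finset.coe_image, Set.mem_image] at hx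
        obtain ⟨i, -, rfl⟩ := hx; exact ⟨i, rfl⟩)
  have hlow : ∀ r ∈ S, Real.exp (p j - ((n - 1) * c + Real.log n)) ≤ r := by
    rintro r ⟨hr, t, htL, htc, hli⟩
    have hex : ∃ x ∈ t, x ∉ Submodule.span ℝ (((Finset.Iio j).image b : Finset _) : Set
        (EuclideanSpace ℝ (Fin n))) := by
      by_contra! hcon
      have h1 : Submodule.span ℝ (t : Set (EuclideanSpace ℝ (Fin n))) ≤
          Submodule.span ℝ (((Finset.Iio j).image b : Finset _) : Set
            (EuclideanSpace ℝ (Fin n))) := Submodule.span_le.2 hcon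
      have h2 := Submodule.finrank_mono h1
      rw [finrank_span_finset_eq_card hli] at h2
      have h3 := finrank_span_finset_le_card (R := ℝ) ((Finset.Iio j).image b)
      have h4 : ((Finset.Iio j).image b).card ≤ j := by
        refine Finset.card_image_le.trans ?_; simp
      rw [Set.finrank] at h3
      omega
    obtain ⟨x, hxt, hx⟩ := hex
    have hi₀ : ∃ i₀, j ≤ i₀ ∧ b.repr x i₀ ≠ 0 := by
      by_contra! hcon
      apply hx
      rw [← b.sum_repr x]
      refine Submodule.sum_mem _ fun i _ => ?_
      by_cases hij : j ≤ i
      · rw [hcon i hij, zero_smul]; exact Submodule.zero_mem _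
      · refine Submodule.smul_mem _ _ (Submodule.subset_span ?_)
        rw [Finset.mem_coe]
        exact Finset.mem_image_of_mem _ (Finset.mem_Iio.2 (not_le.1 hij))
    obtain ⟨i₀, hji, hne⟩ := hi₀
    have hd : coordDet n (Function.update b i₀ x) ≠ 0 := by
      rw [← b.sum_repr x, coordDet_update_sum]
      exact mul_ne_zero hne hdet
    obtain ⟨hxL, hxr⟩ := htL hxt
    rw [mem_smul_bodyC hr] at hxr
    have h1 := exp_le_of_exchange hu hsum hz hz1 hz2 hxL hxr.1 hxr.2 i₀ hd
    have h2 : Real.exp (p i₀ - ((n - 1) * c + Real.log n)) ≤ r := by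
      rw [show p i₀ - ((n - 1) * c + Real.log n) = -((n - 1) * c - p i₀) - Real.log n by ring,
        Real.exp_sub, Real.exp_neg, Real.exp_log hn0, div_le_iff₀ hn0, inv_le_iff_one_le_mul₀
        (Real.exp_pos _)]
      linarith
    refine (Real.exp_le_exp.2 ?_).trans h2
    linarith [hp hji]
  have hmk : minkMin (intLattice n) (bodyC u (Real.exp q)) ((j : ℕ) + 1) = sInf S := rfl
  rw [hmk]
  have hlb : Real.exp (p j - ((n - 1) * c + Real.log n)) ≤ sInf S := le_csInf ⟨_, hmem⟩ hlow
  have hub : sInf S ≤ Real.exp (p j + c) := csInf_le ⟨_, hlow⟩ hmem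
  have hpos : 0 < sInf S := (Real.exp_pos _).trans_le hlb
  have h1 := (Real.le_log_iff_exp_le hpos).2 hlb
  have h2 := (Real.log_le_iff_le_exp hpos).2 hub
  rw [abs_le]
  constructor <;> nlinarith

lemma HasDerivWithinAt.eventually_lt_right {f : ℝ → ℝ} {c k t : ℝ}
    (h : HasDerivWithinAt f c (Set.Ici t) t) (hk : k < c) :
    ∀ᶠ y in nhdsWithin t (Set.Ioi t), f t + k * (y - t) < f y := by
  have h1 := (hasDerivWithinAt_iff_tendsto_slope' (s := Set.Ioi t) (by simp)).1 h.Ioi_of_Ici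
  filter_upwards [h1.eventually (lt_mem_nhds hk), self_mem_nhdsWithin] with y hy hyt
  have hyt : t < y := hyt
  rw [slope_def_field, lt_div_iff₀ (by linarith)] at hy
  linarith

lemma HasDerivWithinAt.eventually_lt_left {f : ℝ → ℝ} {c k s t : ℝ} (hst : s < t)
    (h : HasDerivWithinAt f c (Set.Icc s t) t) (hk : k < c) :
    ∀ᶠ y in nhdsWithin t (Set.Iio t), f y < f t + k * (y - t) := by
  have h0 : HasDerivWithinAt f c (Set.Iio t) t :=
    h.mono_of_mem_nhdsWithin (Icc_mem_nhdsLT_of_mem ⟨hst, le_rfl⟩)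
  have h1 := (hasDerivWithinAt_iff_tendsto_slope' (s := Set.Iio t) (by simp)).1 h0
  filter_upwards [h1.eventually (lt_mem_nhds hk), self_mem_nhdsWithin] with y hy hyt
  have hyt : y < t := hyt
  rw [slope_def_field, lt_div_iff_of_neg (by linarith)] at hy
  linarith

lemma HasDerivWithinAt.eventually_gt_left {f : ℝ → ℝ} {c k s t : ℝ} (hst : s < t)
    (h : HasDerivWithinAt f c (Set.Icc s t) t) (hk : c < k) :
    ∀ᶠ y in nhdsWithin t (Set.Iio t), f t + k * (y - t) < f y := by
  filter_upwards [h.neg.eventually_lt_left hst (neg_lt_neg hk)] with y hy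
  simp only [Pi.neg_apply] at hy
  linarith

section slopes

variable {f : ℝ → ℝ} {q₀ a b x : ℝ}

/-- Without changes of slope from `1` to `0`, once `f` has increased it keeps slope `1`. -/
lemma sub_eq_sub_of_no_change (hc : ContinuousOn f (Set.Ici q₀)) (hs : Slope01On f q₀)
    (ha : q₀ ≤ a) (hax : a < x) (hxb : x ≤ b)
    (hno : ∀ t ∈ Set.Ioo a b, ¬ ChangesSlopeOn f q₀ t) (hne : f x ≠ f a) :
    f b - f x = b - x := by
  by_contra hcon
  have hp : ∃ p ∈ Set.Ico a x, HasDerivWithinAt f 1 (Set.Ici p) p := by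
    by_contra! h
    refine hne (constant_of_has_deriv_right_zero
      (hc.mono fun y hy => ha.trans hy.1) (fun y hy => ?_) x ⟨hax.le, le_rfl⟩)
    exact (hs.1 y (ha.trans hy.1)).resolve_right (h y hy)
  have hp' : ∃ p ∈ Set.Ico x b, HasDerivWithinAt f 0 (Set.Ici p) p := by
    by_contra! h
    have := constant_of_has_deriv_right_zero (f := fun y => f y - y) (a := x) (b := b)
      ((hc.mono fun y hy => ha.trans (hax.le.trans hy.1)).sub continuousOn_id)
      (fun y hy => by
        have h1 := (hs.1 y (ha.trans (hax.le.trans hy.1))).resolve_left (h y hy)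
        have h2 := h1.sub (hasDerivWithinAt_id y (Set.Ici y))
        rw [sub_self] at h2
        exact h2) b ⟨hxb, le_rfl⟩
    apply hcon; linarith
  obtain ⟨p, hp, hdp⟩ := hp
  obtain ⟨p', hp', hdp'⟩ := hp'
  have hpp : p < p' := hp.2.trans_le hp'.1
  have hq₀p : q₀ ≤ p := ha.trans hp.1
  have hleft : HasDerivWithinAt f 0 (Set.Icc q₀ p') p' := by
    refine (hs.2 p' (hq₀p.trans_lt hpp)).resolve_right fun h => ?_
    exact hno p' ⟨hp.1.trans_lt hpp, hp'.2⟩ ⟨h, hdp'⟩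
  obtain ⟨t, ht, hmax⟩ := isCompact_Icc.exists_isMaxOn (Set.nonempty_Icc.2 hpp.le)
    (f := fun y => f y - 1 / 2 * y)
    ((hc.mono fun y hy => hq₀p.trans hy.1).sub (by fun_prop))
  have hmax' : ∀ y ∈ Set.Icc p p', f y - 1 / 2 * y ≤ f t - 1 / 2 * t := fun y hy => hmax hy
  have htp : t ≠ p := by
    rintro rfl
    obtain ⟨y, hy, hy1, hy2⟩ := ((hdp.eventually_lt_right (k := 1 / 2) (by norm_num)).and
      (Ioo_mem_nhdsGT hpp)).exists
    have := hmax' y ⟨hy1.le, hy2.le⟩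
    linarith
  have htp' : t ≠ p' := by
    rintro rfl
    obtain ⟨y, hy, hy1, hy2⟩ := ((hleft.eventually_gt_left (hq₀p.trans_lt hpp)
      (k := 1 / 2) (by norm_num)).and (Ioo_mem_nhdsLT hpp)).exists
    have := hmax' y ⟨hy1.le, hy2.le⟩
    linarith
  have hpt : p < t := lt_of_le_of_ne ht.1 htp.symm
  have htp'' : t < p' := lt_of_le_of_ne ht.2 htp'
  refine hno t ⟨hp.1.trans_lt hpt, htp''.trans hp'.2⟩ ⟨?_, ?_⟩
  · refine (hs.2 t (hq₀p.trans_lt hpt)).resolve_left fun h => ?_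
    obtain ⟨y, hy, hy1, hy2⟩ := ((h.eventually_gt_left (hq₀p.trans_lt hpt)
      (k := 1 / 2) (by norm_num)).and (Ioo_mem_nhdsLT hpt)).exists
    have := hmax' y ⟨hy1.le, hy2.le.trans ht.2⟩
    linarith
  · refine (hs.1 t (hq₀p.trans hpt.le)).resolve_right fun h => ?_
    obtain ⟨y, hy, hy1, hy2⟩ := ((h.eventually_lt_right
      (k := 1 / 2) (by norm_num)).and (Ioo_mem_nhdsGT htp'')).exists
    have := hmax' y ⟨ht.1.trans hy1.le, hy2.le⟩
    linarith

lemma const_or_slope_one (hc : ContinuousOn f (Set.Ici q₀)) (hs : Slope01On f q₀)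
    (ha : q₀ ≤ a) (hno : ∀ t ∈ Set.Ioo a b, ¬ ChangesSlopeOn f q₀ t) :
    (∀ y ∈ Set.Icc a b, f y = f a) ∨ ∃ x ∈ Set.Ico a b, f b - f x = b - x := by
  by_cases h : ∀ y ∈ Set.Ico a b, HasDerivWithinAt f 0 (Set.Ici y) y
  · exact Or.inl (constant_of_has_deriv_right_zero (hc.mono fun y hy => ha.trans hy.1) h)
  · push Not at h
    obtain ⟨p, hp, h0⟩ := h
    have h1 := (hs.1 p (ha.trans hp.1)).resolve_left h0
    obtain ⟨y, hy, hy1, hy2⟩ := ((h1.eventually_lt_right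
      (k := 1 / 2) (by norm_num)).and (Ioo_mem_nhdsGT hp.2)).exists
    refine Or.inr ⟨y, ⟨hp.1.trans hy1.le, hy2⟩, sub_eq_sub_of_no_change hc hs
      (ha.trans hp.1) hy1 hy2.le (fun t ht => hno t ⟨hp.1.trans_lt ht.1, ht.2⟩) ?_⟩
    intro h; linarith

end slopes

lemma Msum_zero {n : ℕ} (P : ℝ → Fin n → ℝ) (q : ℝ) : Msum P 0 q = 0 := by
  simp [Msum]

lemma Msum_succ {n : ℕ} (P : ℝ → Fin n → ℝ) {i : ℕ} (hi : i < n) (q : ℝ) :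
    Msum P (i + 1) q = Msum P i q + P q ⟨i, hi⟩ := by
  have : univ.filter (fun k : Fin n => (k : ℕ) < i + 1) =
      insert ⟨i, hi⟩ (univ.filter (fun k : Fin n => (k : ℕ) < i)) := by
    ext k
    simp only [mem_filter, mem_univ, true_and, mem_insert, Fin.ext_iff]
    omega
  rw [Msum, this, Finset.sum_insert (by simp), add_comm]
  rfl

lemma Msum_self {n : ℕ} (P : ℝ → Fin n → ℝ) (q : ℝ) : Msum P n q = ∑ i, P q i := by
  simp [Msum]

namespace IsNSystem

variable {n : ℕ} {q₀ : ℝ} {P : ℝ → Fin n → ℝ}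

lemma nonneg (hP : IsNSystem n 0 q₀ P) {q : ℝ} (hq : q₀ ≤ q) (j : Fin n) : 0 ≤ P q j := by
  simpa using hP.1 q hq j

lemma le_of_le (hP : IsNSystem n 0 q₀ P) (j : Fin n) {x y : ℝ} (hx : q₀ ≤ x) (hxy : x ≤ y) :
    P x j ≤ P y j := by
  simpa using hP.2.2.1 j x y hx hxy

lemma sorted (hP : IsNSystem n 0 q₀ P) {q : ℝ} (hq : q₀ ≤ q) : Monotone (P q) := by
  cases n with
  | zero => intro i; exact i.elim0
  | succ m =>
    rw [Fin.monotone_iff_le_succ]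
    intro i
    have h := hP.2.1 q hq i.castSucc (by simp)
    rw [add_zero] at h
    exact h

lemma sum_eq (hP : IsNSystem n 0 q₀ P) {q : ℝ} (hq : q₀ ≤ q) : ∑ i, P q i = q := by
  rw [← Msum_self, hP.2.2.2.2.1 q hq]

lemma continuousOn (hP : IsNSystem n 0 q₀ P) (j : Fin n) :
    ContinuousOn (fun q => P q j) (Set.Ici q₀) := by
  have h1 := (hP.2.2.2.1 (j + 1) j.2).1
  have h2 := (hP.2.2.2.1 j j.2.le).1
  refine (h1.sub h2).congr fun q _ => ?_
  simp [Msum_succ P j.2]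

lemma not_changes (hP : IsNSystem n 0 q₀ P) {i : ℕ} (hi : i + 1 < n) {q : ℝ} (hq : q₀ < q)
    (hlt : P q ⟨i, by omega⟩ < P q ⟨i + 1, hi⟩) : ¬ ChangesSlopeOn (Msum P (i + 1)) q₀ q := by
  intro h
  have := hP.2.2.2.2.2 (i + 1) (by omega) hi q hq h
  simp only [Nat.add_sub_cancel, add_zero] at this
  exact absurd hlt (not_lt.2 this)

lemma eq_of_Msum_eq (hP : IsNSystem n 0 q₀ P) {i : ℕ} {x y : ℝ} (hx : q₀ ≤ x) (hxy : x ≤ y)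
    (h : Msum P i y = Msum P i x) {k : Fin n} (hk : (k : ℕ) < i) : P x k = P y k :=
  (Finset.sum_eq_sum_iff_of_le (fun k _ => hP.le_of_le k hx hxy)).1 h.symm k (by simpa using hk)

lemma eq_of_Msum_sub_eq (hP : IsNSystem n 0 q₀ P) {i : ℕ} {x y : ℝ} (hx : q₀ ≤ x) (hxy : x ≤ y)
    (h : Msum P i y - Msum P i x = y - x) {k : Fin n} (hk : i ≤ (k : ℕ)) : P x k = P y k := by
  have key : ∀ q, q₀ ≤ q →
      Msum P i q + ∑ k ∈ univ.filter (fun k : Fin n => ¬ (k : ℕ) < i), P q k = q := by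
    intro q hq
    rw [Msum, Finset.sum_filter_add_sum_filter_not, hP.sum_eq hq]
  have h1 := key x hx
  have h2 := key y (hx.trans hxy)
  refine (Finset.sum_eq_sum_iff_of_le (s := univ.filter (fun k : Fin n => ¬ (k : ℕ) < i))
    (fun k _ => hP.le_of_le k hx hxy)).1 ?_ k (mem_filter.2 ⟨mem_univ k, not_lt.2 hk⟩)
  linarith

/-- A line that has risen strictly below a gap prevents the lines above the gap from moving. -/
lemma eq_of_gap (hP : IsNSystem n 0 q₀ P) {i : ℕ} (hi : i + 1 < n) {a x b : ℝ} (ha : q₀ ≤ a)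
    (hax : a < x) (hxb : x ≤ b)
    (hgap : ∀ q ∈ Set.Ioo a b, P q ⟨i, by omega⟩ < P q ⟨i + 1, hi⟩)
    {j : Fin n} (hj : (j : ℕ) ≤ i) (hrise : P a j < P x j) {k : Fin n} (hk : i + 1 ≤ (k : ℕ)) :
    P x k = P b k := by
  refine hP.eq_of_Msum_sub_eq (ha.trans hax.le) hxb (i := i + 1) ?_ hk
  refine sub_eq_sub_of_no_change (hP.2.2.2.1 (i + 1) hi.le).1 (hP.2.2.2.1 (i + 1) hi.le).2 ha hax
    hxb (fun t ht => hP.not_changes hi (ha.trans_lt ht.1) (hgap t ht)) ?_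
  refine fun h => hrise.ne (hP.eq_of_Msum_eq ha hax.le h (by omega))

/-- Just before any time at most one line moves. -/
lemma exists_single_mover (hP : IsNSystem n 0 q₀ P) {t : ℝ} (ht : q₀ < t) :
    ∃ r : Fin n, ∃ a, q₀ ≤ a ∧ a < t ∧ ∀ i, i ≠ r → P a i = P t i := by
  classical
  have hn : HasDerivWithinAt (Msum P n) 1 (Set.Icc q₀ t) t :=
    (hasDerivWithinAt_id t _).congr (fun y hy => hP.2.2.2.2.1 y hy.1) (hP.2.2.2.2.1 t ht.le)
  have hex : ∃ m, m ≤ n ∧ HasDerivWithinAt (Msum P m) 1 (Set.Icc q₀ t) t := ⟨n, le_rfl, hn⟩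
  obtain ⟨hmn, hm1⟩ := Nat.find_spec hex
  have hmin : ∀ i, i < Nat.find hex → HasDerivWithinAt (Msum P i) 0 (Set.Icc q₀ t) t := by
    intro i hi
    refine ((hP.2.2.2.1 i (hi.le.trans hmn)).2.2 t ht).resolve_right fun h => ?_
    exact Nat.find_min hex hi ⟨hi.le.trans hmn, h⟩
  generalize Nat.find hex = m at *
  obtain _ | r := m
  · exfalso
    obtain ⟨y, hy, hyt⟩ := ((hm1.eventually_lt_left ht (k := 1 / 2) (by norm_num)).and
      self_mem_nhdsWithin).exists
    have : y < t := hyt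
    simp only [Msum_zero] at hy
    linarith
  have hrn : r < n := hmn
  have hr0 := hmin r (by omega)
  have upper : ∃ a, q₀ ≤ a ∧ a < t ∧ ∀ i : Fin n, r + 1 ≤ (i : ℕ) → P a i = P t i := by
    rcases Nat.lt_or_ge (r + 1) n with h | h
    swap
    · exact ⟨q₀, le_rfl, ht, fun i hi => absurd i.2 (by omega)⟩
    have hgap : ∀ᶠ y in nhdsWithin t (Set.Iio t), P y ⟨r, hrn⟩ < P y ⟨r + 1, h⟩ := by
      have hd : ∃ c ≤ (-1 : ℝ), HasDerivWithinAt
          (fun q => Msum P (r + 2) q - Msum P (r + 1) q - (Msum P (r + 1) q - Msum P r q)) c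
          (Set.Icc q₀ t) t := by
        rcases (hP.2.2.2.1 (r + 2) h).2.2 t ht with h2 | h2
        · exact ⟨_, by norm_num, (h2.sub hm1).sub (hm1.sub hr0)⟩
        · exact ⟨_, by norm_num, (h2.sub hm1).sub (hm1.sub hr0)⟩
      obtain ⟨c, hc, hd⟩ := hd
      filter_upwards [hd.eventually_gt_left ht (k := -1 / 2) (by linarith),
        self_mem_nhdsWithin] with y hy hyt
      have hyt : y < t := hyt
      rw [Msum_succ P h, Msum_succ P h, Msum_succ P hrn, Msum_succ P hrn] at hy
      have := hP.sorted ht.le (show (⟨r, hrn⟩ : Fin n) ≤ ⟨r + 1, h⟩ by simp)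
      linarith
    have hlt := hm1.eventually_lt_left ht (k := 1 / 2) (by norm_num)
    obtain ⟨a, hat, ha⟩ := (mem_nhdsLT_iff_exists_Ioo_subset' ht).1
      (hgap.and (hlt.and (Ioo_mem_nhdsLT ht)))
    obtain ⟨a', ha', ha't⟩ := exists_between (Set.mem_Iio.1 hat)
    have hq : q₀ ≤ a' := (ha ⟨ha', ha't⟩).2.2.1.le
    rcases const_or_slope_one (b := t) (hP.2.2.2.1 (r + 1) h.le).1 (hP.2.2.2.1 (r + 1) h.le).2 hq
      (fun y hy => hP.not_changes h (hq.trans_lt hy.1) (ha ⟨ha'.trans hy.1, hy.2⟩).1) with h1 | h1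
    · exfalso
      have h2 := h1 t ⟨ha't.le, le_rfl⟩
      have h3 := (ha ⟨ha', ha't⟩).2.1
      have ha't : a' < t := ha't
      simp only [h2] at h3
      linarith
    · obtain ⟨x, hx, hxt⟩ := h1
      exact ⟨x, hq.trans hx.1, hx.2, fun i hi => hP.eq_of_Msum_sub_eq (hq.trans hx.1) hx.2.le hxt hi⟩
  have lower : ∃ a, q₀ ≤ a ∧ a < t ∧ ∀ i : Fin n, (i : ℕ) < r → P a i = P t i := by
    obtain _ | r := r
    · exact ⟨q₀, le_rfl, ht, fun i hi => absurd hi (by omega)⟩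
    have hr1 := hmin r (by omega)
    have hgap : ∀ᶠ y in nhdsWithin t (Set.Iio t), P y ⟨r, by omega⟩ < P y ⟨r + 1, hrn⟩ := by
      have hd := (hm1.sub hr0).sub (hr0.sub hr1)
      have hpos : 0 < P t ⟨r + 1, hrn⟩ - P t ⟨r, by omega⟩ := by
        obtain ⟨y, hy, hyq, hyt⟩ := ((hd.eventually_lt_left ht (k := 1 / 2) (by norm_num)).and
          (Ioo_mem_nhdsLT ht)).exists
        simp only [Pi.sub_apply] at hy
        rw [Msum_succ P hrn, Msum_succ P hrn, Msum_succ P (show r < n by omega),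
          Msum_succ P (show r < n by omega)] at hy
        have := hP.sorted hyq.le (show (⟨r, by omega⟩ : Fin n) ≤ ⟨r + 1, hrn⟩ by simp)
        linarith
      have hcont : ContinuousWithinAt (fun q => P q ⟨r + 1, hrn⟩ - P q ⟨r, by omega⟩)
          (Set.Iio t) t := by
        refine (((hP.continuousOn _).sub (hP.continuousOn _)) t ht.le).mono_of_mem_nhdsWithin ?_
        exact Filter.mem_of_superset (Ioo_mem_nhdsLT ht) fun y hy => hy.1.le
      filter_upwards [hcont.eventually (lt_mem_nhds hpos)] with y hy
      linarith
    have hlt := hr0.eventually_gt_left ht (k := 1 / 2) (by norm_num)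
    obtain ⟨a, hat, ha⟩ := (mem_nhdsLT_iff_exists_Ioo_subset' ht).1
      (hgap.and (hlt.and (Ioo_mem_nhdsLT ht)))
    obtain ⟨a', ha', ha't⟩ := exists_between (Set.mem_Iio.1 hat)
    have hq : q₀ ≤ a' := (ha ⟨ha', ha't⟩).2.2.1.le
    rcases const_or_slope_one (b := t) (hP.2.2.2.1 (r + 1) hrn.le).1 (hP.2.2.2.1 (r + 1) hrn.le).2
      hq (fun y hy => hP.not_changes hrn (hq.trans_lt hy.1) (ha ⟨ha'.trans hy.1, hy.2⟩).1)
      with h1 | h1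
    · exact ⟨a', hq, ha't, fun i hi =>
        hP.eq_of_Msum_eq hq ha't.le (h1 t ⟨ha't.le, le_rfl⟩) hi⟩
    · exfalso
      obtain ⟨x, hx, hxt⟩ := h1
      have h3 := (ha ⟨ha'.trans_le hx.1, hx.2⟩).2.1
      have := hx.2
      linarith
  obtain ⟨a, ha, hat, hau⟩ := upper
  obtain ⟨b, hb, hbt, hbl⟩ := lower
  refine ⟨⟨r, hrn⟩, max a b, le_max_of_le_left ha, max_lt hat hbt, fun i hi => ?_⟩
  have hi' : (i : ℕ) ≠ r := fun h => hi (Fin.ext h)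
  refine le_antisymm (hP.le_of_le i (le_max_of_le_left ha) (max_lt hat hbt).le) ?_
  rcases Nat.lt_or_ge i r with h | h
  · rw [← hbl i h]; exact hP.le_of_le i hb (le_max_right _ _)
  · rw [← hau i (by omega)]; exact hP.le_of_le i ha (le_max_left _ _)

end IsNSystem

/-- At time `q` the `j`-th line lies in the `A j`-th strip of height `δ`. -/
def InCell {n : ℕ} (P : ℝ → Fin n → ℝ) (δ : ℝ) (A : Fin n → ℕ) (q : ℝ) : Prop :=
  ∀ j, δ * A j ≤ P q j ∧ P q j < δ * (A j + 1)

/-- From time `t` on, the first crossing of a multiple of `δ` occurs at time `t'`, by the line `r`. -/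
def IsNextEvent {n : ℕ} (P : ℝ → Fin n → ℝ) (δ : ℝ) (A : Fin n → ℕ) (t : ℝ) (r : Fin n)
    (t' : ℝ) : Prop :=
  t < t' ∧ (∀ q ∈ Set.Ico t t', InCell P δ A q) ∧ P t' r = δ * (A r + 1) ∧
    InCell P δ (Function.update A r (A r + 1)) t'

namespace IsNSystem

variable {n : ℕ} {q₀ δ : ℝ} {P : ℝ → Fin n → ℝ}

lemma inCell_monotone (hP : IsNSystem n 0 q₀ P) (hδ : 0 < δ) {A : Fin n → ℕ} {q : ℝ} (hq : q₀ ≤ q)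
    (hA : InCell P δ A q) : Monotone A := by
  intro i k hik
  have h1 := (hA i).1.trans_lt ((hP.sorted hq hik).trans_lt (hA k).2)
  have h2 : (A i : ℝ) < A k + 1 := lt_of_mul_lt_mul_left h1 hδ.le
  exact Nat.lt_succ_iff.1 (by exact_mod_cast h2)

lemma exists_inCell (hP : IsNSystem n 0 q₀ P) (hδ : 0 < δ) :
    ∃ A : Fin n → ℕ, InCell P δ A q₀ := by
  refine ⟨fun j => ⌊P q₀ j / δ⌋₊, fun j => ⟨?_, ?_⟩⟩
  · have := Nat.floor_le (div_nonneg (hP.nonneg le_rfl j) hδ.le)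
    rwa [le_div_iff₀ hδ, mul_comm] at this
  · have := Nat.lt_floor_add_one (P q₀ j / δ)
    rwa [div_lt_iff₀ hδ, mul_comm] at this

lemma exists_nextEvent (hP : IsNSystem n 0 q₀ P) (hδ : 0 < δ) {A : Fin n → ℕ} {t : ℝ}
    (ht : q₀ ≤ t) (hA : InCell P δ A t) : ∃ r t', IsNextEvent P δ A t r t' := by
  set U : Set ℝ := ⋃ j, Set.Ici t ∩ (fun q => P q j) ⁻¹' Set.Ici (δ * (A j + 1)) with hU
  have hUc : IsClosed U := isClosed_iUnion_of_finite fun j =>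
    ((hP.continuousOn j).mono (Set.Ici_subset_Ici.2 ht)).preimage_isClosed_of_isClosed
      isClosed_Ici isClosed_Ici
  have hUne : U.Nonempty := by
    by_contra! hemp
    have hlt : ∀ q, t ≤ q → ∀ j, P q j < δ * (A j + 1) := by
      intro q hq j
      by_contra! h
      have : q ∈ U := Set.mem_iUnion.2 ⟨j, hq, h⟩
      rw [hemp] at this
      exact this
    have h1 := hP.sum_eq (ht.trans (le_max_left t (∑ j, δ * ((A j : ℝ) + 1) + 1)))
    have h2 : ∑ j, P (max t (∑ j, δ * ((A j : ℝ) + 1) + 1)) j ≤ ∑ j, δ * ((A j : ℝ) + 1) :=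
      Finset.sum_le_sum fun j _ => (hlt _ (le_max_left _ _) j).le
    have h3 := le_max_right t (∑ j, δ * ((A j : ℝ) + 1) + 1)
    linarith
  have hUb : BddBelow U := ⟨t, fun q hq => by
    obtain ⟨j, hj⟩ := Set.mem_iUnion.1 hq; exact hj.1⟩
  have hmem := hUc.csInf_mem hUne hUb
  set t' := sInf U with ht'
  have hbefore : ∀ q, t ≤ q → q < t' → ∀ j, P q j < δ * (A j + 1) := by
    intro q hq hqt j
    by_contra! h
    exact absurd (csInf_le hUb (Set.mem_iUnion.2 ⟨j, hq, h⟩)) (not_le.2 hqt)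
  obtain ⟨r, hr1, hr2⟩ := Set.mem_iUnion.1 hmem
  have hr1 : t ≤ t' := hr1
  have hr2 : δ * (A r + 1) ≤ P t' r := hr2
  have htt : t < t' := by
    refine lt_of_le_of_ne hr1 fun h => ?_
    rw [← h] at hr2
    exact absurd (hA r).2 (not_lt.2 hr2)
  obtain ⟨r', a, ha, hat, heq⟩ := hP.exists_single_mover (ht.trans_lt htt)
  have hother : ∀ i, i ≠ r' → P t' i < δ * (A i + 1) := by
    intro i hi
    have h1 := hbefore (max a t) (le_max_right _ _) (max_lt hat htt) i
    have h2 := hP.le_of_le i ha (le_max_left a t)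
    rw [heq i hi] at h2
    linarith
  have hrr : r = r' := by
    by_contra h
    exact absurd (hother r h) (not_lt.2 hr2)
  subst hrr
  have heq' : P t' r = δ * (A r + 1) := by
    refine le_antisymm ?_ hr2
    have hcont : ContinuousWithinAt (fun q => P q r) (Set.Ioo t t') t' :=
      (hP.continuousOn r t' (ht.trans hr1)).mono fun y hy => ht.trans hy.1.le
    have : (nhdsWithin t' (Set.Ioo t t')).NeBot := by
      rw [nhdsWithin_Ioo_eq_nhdsLT htt]; infer_instance
    refine le_of_tendsto hcont.tendsto ?_
    filter_upwards [self_mem_nhdsWithin] with y hy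
    exact (hbefore y hy.1.le hy.2 r).le
  refine ⟨r, t', htt, fun q hq j => ⟨(hA j).1.trans (hP.le_of_le j ht hq.1),
    hbefore q hq.1 hq.2 j⟩, heq', fun j => ?_⟩
  rcases eq_or_ne j r with rfl | hj
  · rw [Function.update_self, heq']
    push_cast
    constructor <;> nlinarith
  · rw [Function.update_of_ne hj]
    exact ⟨(hA j).1.trans (hP.le_of_le j ht hr1), hother j hj⟩

lemma nextEvent_le (hP : IsNSystem n 0 q₀ P) (hδ : 0 < δ) {A : Fin n → ℕ} {t t' t'' : ℝ}
    (ht : q₀ ≤ t) {r r' : Fin n} (h : IsNextEvent P δ A t r t')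
    (h' : IsNextEvent P δ (Function.update A r (A r + 1)) t' r' t'') :
    Function.update A r (A r + 1) r' ≤ Function.update A r (A r + 1) r := by
  classical
  obtain ⟨htt, hin, hhit, hcell⟩ := h
  obtain ⟨htt', hin', hhit', -⟩ := h'
  set B := Function.update A r (A r + 1) with hB
  by_contra! hlt
  have hBm : Monotone B := hP.inCell_monotone hδ (ht.trans htt.le) hcell
  have hex : ∃ i : ℕ, ∃ hi : i < n, B r < B ⟨i, hi⟩ := ⟨r', r'.2, hlt⟩
  obtain ⟨hin_lt, hBi⟩ := Nat.find_spec hex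
  have hmin := fun i => Nat.find_min hex (m := i)
  have hle : Nat.find hex ≤ r' := Nat.find_min' hex ⟨r'.2, hlt⟩
  generalize Nat.find hex = i at *
  have hri : (r : ℕ) < i := by
    by_contra! h
    exact absurd (hBm (show (⟨i, hin_lt⟩ : Fin n) ≤ r from h)) (not_le.2 hBi)
  obtain _ | i := i
  · omega
  have hBi' : B ⟨i, by omega⟩ ≤ B r := by
    by_contra! h
    exact hmin i (by omega) ⟨_, h⟩
  have hne : (⟨i + 1, hin_lt⟩ : Fin n) ≠ r := fun h => by rw [← h] at hri; simp at hri
  have hBA : B ⟨i + 1, hin_lt⟩ = A ⟨i + 1, hin_lt⟩ := by rw [hB, Function.update_of_ne hne]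
  have hbig : δ * (B ⟨i, by omega⟩ + 1) ≤ δ * B ⟨i + 1, hin_lt⟩ := by
    refine mul_le_mul_of_nonneg_left ?_ hδ.le
    exact_mod_cast hBi'.trans_lt hBi
  have hgap : ∀ q ∈ Set.Ioo t t'', P q ⟨i, by omega⟩ < P q ⟨i + 1, hin_lt⟩ := by
    intro q hq
    rcases lt_or_ge q t' with h | h
    · have h1 := (hcell ⟨i, by omega⟩).2
      have h2 := hP.le_of_le ⟨i, by omega⟩ (ht.trans hq.1.le) h.le
      have h3 := (hin q ⟨hq.1.le, h⟩ ⟨i + 1, hin_lt⟩).1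
      rw [← hBA] at h3
      linarith
    · have h1 := (hin' q ⟨h, hq.2⟩ ⟨i, by omega⟩).2
      have h2 := (hin' q ⟨h, hq.2⟩ ⟨i + 1, hin_lt⟩).1
      linarith
  have hrise : P t r < P t' r := by rw [hhit]; exact (hin t ⟨le_rfl, htt⟩ r).2
  have := hP.eq_of_gap hin_lt ht htt htt'.le hgap (j := r) (by omega) hrise (k := r') hle
  have h1 := (hcell r').2
  rw [this, hhit'] at h1
  exact lt_irrefl _ h1

/-- Discretization of a system: integer profiles, each obtained from the previous one by raising
one entry, such that the height raised never exceeds the one reached just before. -/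
theorem exists_event_sequence (hP : IsNSystem n 0 q₀ P) (hδ : 0 < δ) :
    ∃ (A : ℕ → Fin n → ℕ) (r : ℕ → Fin n), Monotone (A 0) ∧
      (∀ i, A (i + 1) = Function.update (A i) (r i) (A i (r i) + 1)) ∧
      (∀ i, A (i + 1) (r (i + 1)) ≤ A (i + 1) (r i)) ∧
      ∀ q, q₀ ≤ q → ∃ i, InCell P δ (A i) q := by
  classical
  obtain ⟨A₀, hA₀⟩ := hP.exists_inCell hδ
  let S := {s : ℝ × (Fin n → ℕ) // q₀ ≤ s.1 ∧ InCell P δ s.2 s.1}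
  have hstep : ∀ s : S, ∃ r t', IsNextEvent P δ s.1.2 s.1.1 r t' := fun s =>
    hP.exists_nextEvent hδ s.2.1 s.2.2
  choose R T hRT using hstep
  let next : S → S := fun s => ⟨(T s, Function.update s.1.2 (R s) (s.1.2 (R s) + 1)),
    s.2.1.trans (hRT s).1.le, (hRT s).2.2.2⟩
  let seq : ℕ → S := fun i => next^[i] ⟨(q₀, A₀), le_rfl, hA₀⟩
  have hseq : ∀ i, seq (i + 1) = next (seq i) := fun i => Function.iterate_succ_apply' _ _ _
  refine ⟨fun i => (seq i).1.2, fun i => R (seq i), hP.inCell_monotone hδ le_rfl hA₀,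
    fun i => by simp only [hseq, next], fun i => ?_, fun q hq => ?_⟩
  · have h1 := hRT (seq i)
    have h2 := hRT (seq (i + 1))
    have h3 : (seq (i + 1)).1.2 = Function.update (seq i).1.2 (R (seq i))
      ((seq i).1.2 (R (seq i)) + 1) := by rw [hseq]
    have h4 : (seq (i + 1)).1.1 = T (seq i) := by rw [hseq]
    rw [h3, h4] at h2
    have h5 := hP.nextEvent_le hδ (seq i).2.1 h1 h2
    rw [← h3] at h5
    exact h5
  · have hsum : ∀ i, i ≤ ∑ j, (seq i).1.2 j := by
      intro i
      induction i with
      | zero => exact Nat.zero_le _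
      | succ i ih =>
        rw [hseq]
        change i + 1 ≤ ∑ j, Function.update (seq i).1.2 (R (seq i)) ((seq i).1.2 (R (seq i)) + 1) j
        rw [Finset.sum_update_of_mem (mem_univ _)]
        have := Finset.add_sum_erase univ (seq i).1.2 (mem_univ (R (seq i)))
        rw [Finset.sdiff_singleton_eq_erase]
        omega
    have hT : ∀ i : ℕ, δ * i ≤ (seq i).1.1 := by
      intro i
      rw [← hP.sum_eq (seq i).2.1]
      calc δ * i ≤ δ * ∑ j, ((seq i).1.2 j : ℝ) :=
            mul_le_mul_of_nonneg_left (by exact_mod_cast hsum i) hδ.le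
        _ ≤ _ := by
            rw [Finset.mul_sum]
            exact Finset.sum_le_sum fun j _ => ((seq i).2.2 j).1
    have hex : ∃ i, q < (seq i).1.1 := by
      obtain ⟨i, hi⟩ := exists_nat_gt (q / δ)
      rw [div_lt_iff₀ hδ, mul_comm] at hi
      exact ⟨i, hi.trans_le (hT i)⟩
    have h1 := Nat.find_spec hex
    have h2 := fun i => Nat.find_min hex (m := i)
    generalize Nat.find hex = i at *
    obtain _ | i := i
    · exact absurd h1 (not_lt.2 hq)
    refine ⟨i, (hRT (seq i)).2.1 q ⟨not_lt.1 (h2 i (by omega)), ?_⟩⟩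
    rw [hseq] at h1
    exact h1

end IsNSystem

/-- The ratio between consecutive scales of the construction. -/
def scaleRatio (n : ℕ) : ℝ := 2 ^ (2 * n + 8)

lemma scaleRatio_eq (n : ℕ) : scaleRatio n = 256 * 4 ^ n := by
  rw [scaleRatio, pow_add, pow_mul]; norm_num; ring

lemma scaleRatio_pos (n : ℕ) : 0 < scaleRatio n := by unfold scaleRatio; positivity

lemma one_le_four_pow (n : ℕ) : (1 : ℝ) ≤ 4 ^ n := one_le_pow₀ (by norm_num)

lemma le_scaleRatio (n : ℕ) : 256 ≤ scaleRatio n := by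
  rw [scaleRatio_eq]; linarith [one_le_four_pow n]

lemma natCast_le_scaleRatio (n : ℕ) : 256 * (n : ℝ) ≤ scaleRatio n := by
  rw [scaleRatio_eq]
  have : (n : ℝ) ≤ 4 ^ n := by exact_mod_cast (Nat.lt_pow_self (by norm_num)).le
  linarith

lemma scaleRatio_mul_pow_le {n s t : ℕ} (h : s < t) :
    scaleRatio n * scaleRatio n ^ s ≤ scaleRatio n ^ t := by
  rw [← pow_succ']
  exact pow_le_pow_right₀ (by linarith [le_scaleRatio n]) h

lemma intLattice_sum {n : ℕ} {ι : Type*} (t : Finset ι) {z : ι → EuclideanSpace ℝ (Fin n)}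
    (hz : ∀ i, z i ∈ intLattice n) (a : ι → ℤ) :
    ∑ i ∈ t, (a i : ℝ) • z i ∈ intLattice n := by
  intro j
  choose f hf using fun i => hz i j
  exact ⟨∑ i ∈ t, a i * f i, by simp [hf]⟩

/-- The determinant of a matrix which is triangular with respect to an injective ranking. -/
lemma det_eq_prod_of_rank {n : ℕ} {M : Matrix (Fin n) (Fin n) ℝ} {b : Fin n → ℕ}
    (hb : Function.Injective b) (h : ∀ i j, b j < b i → M i j = 0) :
    M.det = ∏ i, M i i := by
  have hM : M.BlockTriangular b := fun i j hij => h i j hij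
  rw [hM.det, Finset.prod_image hb.injOn]
  refine Finset.prod_congr rfl fun i _ => ?_
  let : Unique {k // b k = b i} := ⟨⟨⟨i, rfl⟩⟩, fun k => Subtype.ext (hb k.2)⟩
  rw [Matrix.det_unique]
  rfl

lemma det_inner_eq {n : ℕ} (x y : Fin n → EuclideanSpace ℝ (Fin n)) :
    Matrix.det (Matrix.of fun i j => ⟪x i, y j⟫) = coordDet n x * coordDet n y := by
  rw [coordDet_apply, coordDet_apply, ← Matrix.det_transpose (Matrix.of fun i j => x j i),
    ← Matrix.det_mul]
  congr 1
  ext i j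
  simp [Matrix.mul_apply, PiLp.inner_apply, mul_comm]

/-- The data of the construction: integer vectors `z` of size about `ρ ^ s`, dual vectors `v`,
target heights `ν`, a distinguished moving label `μ`, and a normal `u` to the other vectors. -/
structure Config (n : ℕ) where
  z : Fin n → EuclideanSpace ℝ (Fin n)
  v : Fin n → EuclideanSpace ℝ (Fin n)
  s : Fin n → ℕ
  ν : Fin n → ℕ
  μ : Fin n
  u : EuclideanSpace ℝ (Fin n)

/-- The invariants of the construction. -/
structure Config.Valid {n : ℕ} (C : Config n) : Prop where
  int : ∀ k, C.z k ∈ intLattice n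
  det : |coordDet n C.z| = 1
  inj : ∀ i j, i ≠ C.μ → j ≠ C.μ → C.s i = C.s j → i = j
  lower : ∀ k, k ≠ C.μ → C.ν k ≤ C.s k
  upper : ∀ k, k ≠ C.μ → C.s k ≤ C.ν k + n
  mover : C.s C.μ < C.ν C.μ
  norm_z : ∀ k, ‖C.z k‖ ≤ 3 / 2 * scaleRatio n ^ C.s k
  orth : ∀ i j, i ≠ C.μ → j ≠ C.μ → C.s j < C.s i → ⟪C.v i, C.z j⟫ = 0
  pair : ∀ i, i ≠ C.μ → 3 / 4 * scaleRatio n ^ C.s i ≤ ⟪C.v i, C.z i⟫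
  norm_v : ∀ i, i ≠ C.μ → ‖C.v i‖ ≤ 3 / 2
  reserve : ∀ i, i ≠ C.μ → C.s C.μ < C.s i →
    ‖C.v i‖ + |⟪C.v i, C.z C.μ⟫| / (12 * scaleRatio n ^ C.s C.μ) ≤ 3 / 2
  norm_u : ‖C.u‖ = 1
  orth_u : ∀ k, k ≠ C.μ → ⟪C.u, C.z k⟫ = 0

namespace Config.Valid

variable {n : ℕ} {C : Config n}

lemma pair_pos (hC : C.Valid) {i : Fin n} (hi : i ≠ C.μ) : 0 < ⟪C.v i, C.z i⟫ :=
  lt_of_lt_of_le (by have := scaleRatio_pos n; positivity) (hC.pair i hi)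

/-- The moving vector is nearly orthogonal to `u`. -/
lemma abs_inner_mover_le (hC : C.Valid) :
    |⟪C.u, C.z C.μ⟫| * scaleRatio n ^ ∑ k, C.ν k ≤ 2 ^ n * scaleRatio n ^ C.ν C.μ := by
  classical
  have hρ := scaleRatio_pos n
  set φ : Fin n → EuclideanSpace ℝ (Fin n) := Function.update C.v C.μ C.u with hφ
  have hφne : ∀ i, i ≠ C.μ → φ i = C.v i := fun i hi => Function.update_of_ne hi _ _
  have hφμ : φ C.μ = C.u := Function.update_self _ _ _
  let b : Fin n → ℕ := fun i => if i = C.μ then ∑ k, C.s k + 1 else C.s i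
  have hle : ∀ i, C.s i ≤ ∑ k, C.s k := fun i =>
    Finset.single_le_sum (f := C.s) (fun _ _ => Nat.zero_le _) (mem_univ i)
  have hb : Function.Injective b := by
    intro i j hij
    simp only [b] at hij
    have hi := hle i
    have hj := hle j
    split_ifs at hij with h1 h2 h2
    · rw [h1, h2]
    · omega
    · omega
    · exact hC.inj i j h1 h2 hij
  have hdet := det_inner_eq φ C.z
  rw [det_eq_prod_of_rank (b := b) hb] at hdet
  · have habs : ∏ i, |⟪φ i, C.z i⟫| ≤ ∏ i, ‖φ i‖ := by
      rw [← Finset.abs_prod]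
      simp only [Matrix.of_apply] at hdet
      rw [hdet, abs_mul, hC.det, mul_one]
      exact abs_coordDet_le φ
    rw [← Finset.mul_prod_erase _ _ (mem_univ C.μ), ← Finset.mul_prod_erase _ (fun i => ‖φ i‖)
      (mem_univ C.μ), hφμ, hC.norm_u, one_mul] at habs
    have h1 : ∏ i ∈ univ.erase C.μ, (3 / 4 * scaleRatio n ^ C.ν i) ≤
        ∏ i ∈ univ.erase C.μ, |⟪φ i, C.z i⟫| := by
      refine Finset.prod_le_prod (fun i _ => by positivity) fun i hi => ?_
      have hi := Finset.ne_of_mem_erase hi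
      rw [hφne i hi]
      refine le_trans ?_ ((hC.pair i hi).trans (le_abs_self _))
      refine mul_le_mul_of_nonneg_left (pow_le_pow_right₀ ?_ (hC.lower i hi)) (by norm_num)
      linarith [le_scaleRatio n]
    have h2 : ∏ i ∈ univ.erase C.μ, ‖φ i‖ ≤ ∏ i ∈ univ.erase C.μ, (3 / 2 : ℝ) := by
      refine Finset.prod_le_prod (fun i _ => norm_nonneg _) fun i hi => ?_
      have hi := Finset.ne_of_mem_erase hi
      rw [hφne i hi]
      exact hC.norm_v i hi
    have hcard : (univ.erase C.μ).card = n - 1 := by simp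
    rw [Finset.prod_mul_distrib, Finset.prod_const, hcard, Finset.prod_pow_eq_pow_sum] at h1
    rw [Finset.prod_const, hcard] at h2
    have h3 : |⟪C.u, C.z C.μ⟫| * ((3 / 4) ^ (n - 1) *
        scaleRatio n ^ ∑ i ∈ univ.erase C.μ, C.ν i) ≤ (3 / 2) ^ (n - 1) :=
      (mul_le_mul_of_nonneg_left h1 (abs_nonneg _)).trans (habs.trans h2)
    have h4 : ((3 : ℝ) / 2) ^ (n - 1) = 2 ^ (n - 1) * (3 / 4) ^ (n - 1) := by
      rw [← mul_pow]; norm_num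
    have h5 : |⟪C.u, C.z C.μ⟫| * scaleRatio n ^ ∑ i ∈ univ.erase C.μ, C.ν i ≤ 2 ^ (n - 1) := by
      refine le_of_mul_le_mul_right (a := (3 / 4 : ℝ) ^ (n - 1)) ?_ (by positivity)
      rw [← h4]; linarith
    have h6 : (2 : ℝ) ^ (n - 1) ≤ 2 ^ n := pow_le_pow_right₀ (by norm_num) (by omega)
    rw [← Finset.add_sum_erase _ _ (mem_univ C.μ), pow_add, mul_left_comm, mul_comm (2 ^ n)]
    exact mul_le_mul_of_nonneg_left (h5.trans h6) (by positivity)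
  · intro i j hij
    simp only [Matrix.of_apply]
    have hj : j ≠ C.μ := by
      rintro rfl
      have := hle i
      simp only [b, if_true] at hij
      split_ifs at hij <;> omega
    rcases eq_or_ne i C.μ with rfl | hi
    · rw [hφμ]; exact hC.orth_u j hj
    · rw [hφne i hi]
      refine hC.orth i j hi hj ?_
      simpa [b, hi, hj] using hij

/-- A vector of controlled length orthogonal to all `z j` but `z κ` and the moving one. -/
lemma exists_dual (hC : C.Valid) {κ : Fin n} (hκ : κ ≠ C.μ) :
    ∃ w : EuclideanSpace ℝ (Fin n), (∀ j, j ≠ C.μ → j ≠ κ → ⟪w, C.z j⟫ = 0) ∧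
      3 / 4 * scaleRatio n ^ C.s κ ≤ ⟪w, C.z κ⟫ ∧ ‖w‖ ≤ 3 / 2 * 4 ^ n := by
  classical
  have key : ∀ F : Finset (Fin n), (∀ j ∈ F, j ≠ C.μ ∧ C.s κ < C.s j) →
      ∃ w : EuclideanSpace ℝ (Fin n), (∀ j, j ≠ C.μ → (j ∈ F ∨ C.s j < C.s κ) → ⟪w, C.z j⟫ = 0) ∧
      ⟪w, C.z κ⟫ = ⟪C.v κ, C.z κ⟫ ∧ ‖w‖ ≤ 3 / 2 * 4 ^ F.card := by
    intro F
    induction F using Finset.induction_on_max_value C.s with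
    | empty =>
      intro _
      refine ⟨C.v κ, fun j hj h => hC.orth κ j hκ hj (by simpa using h), rfl, ?_⟩
      simpa using hC.norm_v κ hκ
    | insert a F ha hmax ih =>
      intro hF
      obtain ⟨w, hw, hwκ, hwn⟩ := ih fun j hj => hF j (mem_insert_of_mem hj)
      obtain ⟨haμ, haκ⟩ := hF a (mem_insert_self _ _)
      have hpos := hC.pair_pos haμ
      refine ⟨w - (⟪w, C.z a⟫ / ⟪C.v a, C.z a⟫) • C.v a, fun j hj h => ?_, ?_, ?_⟩
      · rw [inner_sub_left, real_inner_smul_left]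
        rcases eq_or_ne j a with rfl | hja
        · rw [div_mul_cancel₀ _ hpos.ne', sub_self]
        · have h' : j ∈ F ∨ C.s j < C.s κ := by
            rcases h with h | h
            · exact Or.inl ((mem_insert.1 h).resolve_left hja)
            · exact Or.inr h
          have hlt : C.s j < C.s a := by
            rcases h' with h | h
            · exact lt_of_le_of_ne (hmax j h) fun h => hja (hC.inj j a hj haμ h)
            · exact h.trans haκ
          rw [hw j hj h', hC.orth a j haμ hj hlt, mul_zero, sub_zero]
      · rw [inner_sub_left, real_inner_smul_left, hC.orth a κ haμ hκ haκ, mul_zero, sub_zero, hwκ]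
      · rw [card_insert_of_notMem ha]
        have hfac : ‖(⟪w, C.z a⟫ / ⟪C.v a, C.z a⟫) • C.v a‖ ≤ 3 * ‖w‖ := by
          rw [norm_smul, Real.norm_eq_abs, abs_div, abs_of_pos hpos, div_mul_eq_mul_div,
            div_le_iff₀ hpos]
          calc |⟪w, C.z a⟫| * ‖C.v a‖ ≤ (‖w‖ * (3 / 2 * scaleRatio n ^ C.s a)) * (3 / 2) := by
                refine mul_le_mul ?_ (hC.norm_v a haμ) (norm_nonneg _) ?_
                · exact (abs_real_inner_le_norm _ _).trans
                    (mul_le_mul_of_nonneg_left (hC.norm_z a) (norm_nonneg _))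
                · have := scaleRatio_pos n; positivity
            _ = 3 * ‖w‖ * (3 / 4 * scaleRatio n ^ C.s a) := by ring
            _ ≤ 3 * ‖w‖ * ⟪C.v a, C.z a⟫ :=
                mul_le_mul_of_nonneg_left (hC.pair a haμ) (by positivity)
        calc _ ≤ ‖w‖ + ‖(⟪w, C.z a⟫ / ⟪C.v a, C.z a⟫) • C.v a‖ := norm_sub_le _ _
          _ ≤ 4 * ‖w‖ := by linarith
          _ ≤ 4 * (3 / 2 * 4 ^ F.card) := by linarith
          _ = _ := by ring
  obtain ⟨w, hw, hwκ, hwn⟩ := key (univ.filter fun j => j ≠ C.μ ∧ C.s κ < C.s j) (by simp)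
  refine ⟨w, fun j hj hjκ => hw j hj ?_, hwκ ▸ hC.pair κ hκ, hwn.trans ?_⟩
  · rcases lt_trichotomy (C.s j) (C.s κ) with h | h | h
    · exact Or.inr h
    · exact absurd (hC.inj j κ hj hκ h) hjκ
    · exact Or.inl (by simp [hj, h])
  · refine mul_le_mul_of_nonneg_left (pow_le_pow_right₀ (by norm_num) ?_) (by norm_num)
    exact (Finset.card_le_univ _).trans (by simp)

/-- A free scale just above the target of the moving vector. -/
lemma exists_free_scale (C : Config n) : ∃ t, C.ν C.μ ≤ t ∧ t ≤ C.ν C.μ + n ∧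
    ∀ j, j ≠ C.μ → C.s j ≠ t := by
  classical
  by_contra! hcon
  have hsub : Finset.Icc (C.ν C.μ) (C.ν C.μ + n) ⊆ univ.image C.s := by
    intro t ht
    rw [Finset.mem_Icc] at ht
    obtain ⟨j, -, hj⟩ := hcon t ht.1 ht.2
    exact mem_image.2 ⟨j, mem_univ j, hj⟩
  have h1 := Finset.card_le_card hsub
  have h2 := Finset.card_image_le (s := univ) (f := C.s)
  simp at h1 h2
  omega

/-- The vector replacing the moving one, close to a prescribed multiple of the component of `z κ`
orthogonal to the vectors of smaller scale. -/
lemma exists_new_vector (hC : C.Valid) {κ : Fin n} (hκ : κ ≠ C.μ) {t : ℕ} (htκ : C.s κ < t)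
    (htμ : C.s C.μ < t) {w : EuclideanSpace ℝ (Fin n)}
    (hw : ∀ j, j ≠ C.μ → j ≠ κ → ⟪w, C.z j⟫ = 0)
    (hwκ : 3 / 4 * scaleRatio n ^ C.s κ ≤ ⟪w, C.z κ⟫) (hwn : ‖w‖ ≤ 3 / 2 * 4 ^ n) :
    ∃ (a : Fin n → ℤ) (w₀ : EuclideanSpace ℝ (Fin n)), a C.μ = 1 ∧
      (∀ k, k ≠ C.μ → t ≤ C.s k → a k = 0) ∧ ‖w₀‖ = 1 ∧
      (∀ j, j ≠ C.μ → j ≠ κ → C.s j < t → ⟪w₀, C.z j⟫ = 0) ∧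
      ‖∑ k, (a k : ℝ) • C.z k‖ ≤ 3 / 2 * scaleRatio n ^ t ∧
      3 / 4 * scaleRatio n ^ t ≤ ⟪w₀, ∑ k, (a k : ℝ) • C.z k⟫ ∧
      1 / 4 * scaleRatio n ^ t ≤ ⟪w, ∑ k, (a k : ℝ) • C.z k⟫ := by
  classical
  have hρ := scaleRatio_pos n
  have hρ256 := le_scaleRatio n
  set ρ := scaleRatio n with hρdef
  have hR : 0 < ρ ^ t := pow_pos hρ t
  have hwpos : 0 < ⟪w, C.z κ⟫ := lt_of_lt_of_le (by positivity) hwκ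
  set F : Finset (Fin n) := univ.filter fun j => j ≠ C.μ ∧ j ≠ κ ∧ C.s j < t with hF
  have hFmem : ∀ j, j ∈ F ↔ j ≠ C.μ ∧ j ≠ κ ∧ C.s j < t := by simp [hF]
  set K := Submodule.span ℝ (C.z '' F) with hK
  set p := K.starProjection (C.z κ) with hp
  have hpK : p ∈ K := K.starProjection_apply_mem _
  set r := C.z κ - p with hr
  have hrK : r ∈ Kᗮ := K.sub_starProjection_mem_orthogonal _
  have hrp : ⟪r, p⟫ = 0 := by rw [real_inner_comm]; exact hrK p hpK
  have hrz : ⟪r, C.z κ⟫ = ‖r‖ ^ 2 := by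
    rw [← real_inner_self_eq_norm_sq]
    nth_rewrite 3 [hr]
    rw [inner_sub_right, hrp, sub_zero]
  have hwp : ⟪w, p⟫ = 0 := by
    have : K ≤ (ℝ ∙ w)ᗮ := by
      rw [hK, Submodule.span_le]
      rintro _ ⟨j, hj, rfl⟩
      rw [SetLike.mem_coe, Submodule.mem_orthogonal_singleton_iff_inner_right]
      have := (hFmem j).1 hj
      exact hw j this.1 this.2.1
    exact Submodule.mem_orthogonal_singleton_iff_inner_right.1 (this hpK)
  have hr0 : r ≠ 0 := by
    intro h
    have h1 : ⟪w, r⟫ = ⟪w, C.z κ⟫ := by rw [hr, inner_sub_right, hwp, sub_zero]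
    rw [h, inner_zero_right] at h1
    exact hwpos.ne h1
  have hrpos : 0 < ‖r‖ := norm_pos_iff.2 hr0
  have hrn : ‖r‖ ≤ 3 / 2 * ρ ^ C.s κ := by
    have h1 := real_inner_le_norm r (C.z κ)
    rw [hrz, sq] at h1
    exact (le_of_mul_le_mul_left h1 hrpos).trans (hC.norm_z κ)
  obtain ⟨c, hc⟩ := (Submodule.mem_span_image_finset_iff_exists_fun' ℝ).1 hpK
  set τ : ℝ := ρ ^ t / ‖r‖ with hτ
  have hτpos : 0 < τ := by positivity
  have hτr : τ * ‖r‖ = ρ ^ t := div_mul_cancel₀ _ hrpos.ne'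
  let b : Fin n → ℝ := fun k => if k = κ then τ else if k ∈ F then -τ * c k else 0
  have hκF : κ ∉ F := by simp [hF]
  have hb : ∑ k, b k • C.z k = τ • r := by
    rw [← Finset.add_sum_erase _ _ (mem_univ κ), hr, smul_sub, sub_eq_add_neg]
    congr 1
    · simp [b]
    · rw [← hc, Finset.smul_sum, ← Finset.sum_neg_distrib]
      symm
      refine Finset.sum_subset_zero_on_sdiff (fun k hk => ?_) (fun k hk => ?_) fun k hk => ?_
      · exact mem_erase.2 ⟨fun h => hκF (h ▸ hk), mem_univ k⟩
      · have h1 := mem_sdiff.1 hk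
        simp [b, Finset.ne_of_mem_erase h1.1, h1.2]
      · have : k ≠ κ := fun h => hκF (h ▸ hk)
        simp [b, this, hk, smul_smul]
  let a : Fin n → ℤ := fun k => if k = C.μ then 1 else round (b k)
  have hbμ : b C.μ = 0 := by simp [b, hκ.symm, hF]
  have haμ : a C.μ = 1 := by simp [a]
  have hbig : ∀ k, k ≠ C.μ → t ≤ C.s k → b k = 0 := by
    intro k hk hkt
    have h1 : k ≠ κ := by rintro rfl; omega
    have h2 : k ∉ F := fun h => by have := ((hFmem k).1 h).2.2; omega
    simp [b, h1, h2]
  have habig : ∀ k, k ≠ C.μ → t ≤ C.s k → a k = 0 := by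
    intro k hk hkt
    simp [a, hk, hbig k hk hkt]
  set x := ∑ k, (a k : ℝ) • C.z k with hx
  have hterm : ∀ k, ‖((a k : ℝ) - b k) • C.z k‖ * ρ ≤ 3 / 2 * ρ ^ t := by
    intro k
    have hsmall : C.s k < t → |(a k : ℝ) - b k| ≤ 1 →
        ‖((a k : ℝ) - b k) • C.z k‖ * ρ ≤ 3 / 2 * ρ ^ t := by
      intro h1 h2
      rw [norm_smul, Real.norm_eq_abs]
      calc _ ≤ 1 * (3 / 2 * ρ ^ C.s k) * ρ := by
            gcongr
            exact hC.norm_z k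
        _ = 3 / 2 * (ρ * ρ ^ C.s k) := by ring
        _ ≤ _ := by gcongr; exact scaleRatio_mul_pow_le h1
    rcases eq_or_ne k C.μ with rfl | hk
    · exact hsmall htμ (by simp [haμ, hbμ])
    rcases lt_or_ge (C.s k) t with h | h
    · refine hsmall h ?_
      have : a k = round (b k) := by simp [a, hk]
      rw [this, abs_sub_comm]
      exact (abs_sub_round _).trans (by norm_num)
    · rw [habig k hk h, hbig k hk h]
      simp; positivity
  have hdiff : ‖x - τ • r‖ ≤ 1 / 16 * ρ ^ t := by
    have h1 : x - τ • r = ∑ k, ((a k : ℝ) - b k) • C.z k := by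
      rw [← hb, hx, ← Finset.sum_sub_distrib]
      exact Finset.sum_congr rfl fun k _ => (sub_smul _ _ _).symm
    have h2 : ‖x - τ • r‖ * ρ ≤ n * (3 / 2 * ρ ^ t) := by
      rw [h1]
      calc _ ≤ (∑ k, ‖((a k : ℝ) - b k) • C.z k‖) * ρ :=
            mul_le_mul_of_nonneg_right (norm_sum_le _ _) hρ.le
        _ ≤ ∑ k : Fin n, 3 / 2 * ρ ^ t := by
            rw [Finset.sum_mul]; exact Finset.sum_le_sum fun k _ => hterm k
        _ = _ := by simp
    have h3 : 256 * (n : ℝ) * ρ ^ t ≤ ρ * ρ ^ t :=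
      mul_le_mul_of_nonneg_right (natCast_le_scaleRatio n) hR.le
    refine le_of_mul_le_mul_right (a := ρ) ?_ hρ
    nlinarith
  have hTn : ‖τ • r‖ = ρ ^ t := by rw [norm_smul, Real.norm_eq_abs, abs_of_pos hτpos, hτr]
  refine ⟨a, ‖r‖⁻¹ • r, haμ, habig, ?_, ?_, ?_, ?_, ?_⟩
  · rw [norm_smul, norm_inv, norm_norm, inv_mul_cancel₀ hrpos.ne']
  · intro j hj hjκ hjt
    rw [real_inner_smul_left, real_inner_comm, hrK (C.z j), mul_zero]
    exact Submodule.subset_span ⟨j, (hFmem j).2 ⟨hj, hjκ, hjt⟩, rfl⟩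
  · have h1 : ‖x‖ ≤ ‖x - τ • r‖ + ‖τ • r‖ := by
      simpa using norm_add_le (x - τ • r) (τ • r)
    linarith
  · have h1 : ⟪‖r‖⁻¹ • r, x⟫ = ρ ^ t + ⟪‖r‖⁻¹ • r, x - τ • r⟫ := by
      rw [inner_sub_right, real_inner_smul_left _ (τ • r), real_inner_smul_right,
        real_inner_self_eq_norm_sq, ← hτr]
      field_simp
      ring
    have h2 := abs_real_inner_le_norm (‖r‖⁻¹ • r) (x - τ • r)
    rw [norm_smul, norm_inv, norm_norm, inv_mul_cancel₀ hrpos.ne', one_mul] at h2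
    have h3 := neg_abs_le ⟪‖r‖⁻¹ • r, x - τ • r⟫
    linarith
  · have h1 : ⟪w, x⟫ = ⟪w, C.z C.μ⟫ + a κ * ⟪w, C.z κ⟫ := by
      rw [hx, inner_sum, Finset.sum_eq_add C.μ κ hκ.symm]
      · rw [real_inner_smul_right, real_inner_smul_right, haμ]; simp
      · intro k _ hk
        rw [real_inner_smul_right, hw k hk.1 hk.2, mul_zero]
      · simp
      · simp
    have haκ : τ - 1 / 2 ≤ a κ := by
      have h2 : a κ = round τ := by simp [a, hκ, b]
      have h3 := (abs_le.1 (abs_sub_round τ)).2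
      rw [h2]; linarith
    have hτκ : 2 / 3 * ρ ^ t ≤ τ * ρ ^ C.s κ := by
      rw [← hτr]; nlinarith
    have hκt : ρ * ρ ^ C.s κ ≤ ρ ^ t := scaleRatio_mul_pow_le htκ
    have hμt : ρ * ρ ^ C.s C.μ ≤ ρ ^ t := scaleRatio_mul_pow_le htμ
    have hsκ : 0 < ρ ^ C.s κ := pow_pos hρ _
    have hsμ : 0 < ρ ^ C.s C.μ := pow_pos hρ _
    have hκt' : 256 * ρ ^ C.s κ ≤ ρ ^ t := by nlinarith
    have hμ1 : |⟪w, C.z C.μ⟫| ≤ 9 / 4 * (4 ^ n * ρ ^ C.s C.μ) := by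
      refine (abs_real_inner_le_norm _ _).trans ?_
      calc _ ≤ (3 / 2 * 4 ^ n) * (3 / 2 * ρ ^ C.s C.μ) := by
            gcongr
            exact hC.norm_z _
        _ = _ := by ring
    have hμ2 : 256 * (4 ^ n * ρ ^ C.s C.μ) ≤ ρ ^ t := by
      rw [← mul_assoc, ← scaleRatio_eq]; exact hμt
    have hτhalf : 1 / 2 ≤ τ := by
      have : 2 / 3 * (256 * ρ ^ C.s κ) ≤ τ * ρ ^ C.s κ := le_trans (by linarith) hτκ
      nlinarith
    have h2 : (τ - 1 / 2) * (3 / 4 * ρ ^ C.s κ) ≤ a κ * ⟪w, C.z κ⟫ :=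
      mul_le_mul haκ hwκ (by positivity) (by linarith)
    have h3 := neg_abs_le ⟪w, C.z C.μ⟫
    have h4 : (τ - 1 / 2) * (3 / 4 * ρ ^ C.s κ) =
      3 / 4 * (τ * ρ ^ C.s κ) - 3 / 8 * ρ ^ C.s κ := by ring
    rw [h1]
    linarith

end Config.Valid

lemma norm_normalize_sub_le {n : ℕ} {u y : EuclideanSpace ℝ (Fin n)} (hu : ‖u‖ = 1) (hy : y ≠ 0) :
    ‖‖y‖⁻¹ • y - u‖ ≤ 2 * ‖y - u‖ := by
  have hpos : 0 < ‖y‖ := norm_pos_iff.2 hy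
  have h1 : ‖‖y‖⁻¹ • y - y‖ ≤ ‖y - u‖ := by
    have : ‖y‖⁻¹ • y - y = (‖y‖⁻¹ - 1) • y := by rw [sub_smul, one_smul]
    rw [this, norm_smul, Real.norm_eq_abs, ← abs_of_pos hpos, ← abs_mul, abs_of_pos hpos, sub_mul,
      inv_mul_cancel₀ hpos.ne', one_mul, ← hu, abs_sub_comm]
    exact abs_norm_sub_norm_le y u
  calc _ = ‖(‖y‖⁻¹ • y - y) + (y - u)‖ := by rw [sub_add_sub_cancel]
    _ ≤ ‖‖y‖⁻¹ • y - y‖ + ‖y - u‖ := norm_add_le _ _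
    _ ≤ _ := by linarith

namespace Config.Valid

variable {n : ℕ} {C : Config n}

/-- Fixing the moving vector at a new scale and releasing `z κ`. -/
theorem exists_switch (hC : C.Valid) {κ : Fin n} (hκ : κ ≠ C.μ) (hlt : C.s κ < C.ν C.μ)
    (hνκ : C.ν κ = C.s κ) :
    ∃ C' : Config n, C'.Valid ∧ C'.ν = Function.update C.ν κ (C.ν κ + 1) ∧ C'.μ = κ ∧
      ‖C'.u - C.u‖ * scaleRatio n ^ ∑ k, C.ν k ≤ 12 * 8 ^ n := by
  classical
  obtain ⟨t, ht1, ht2, htfree⟩ := exists_free_scale C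
  obtain ⟨w, hw, hwκ, hwn⟩ := hC.exists_dual hκ
  have htκ : C.s κ < t := hlt.trans_le ht1
  have htμ : C.s C.μ < t := hC.mover.trans_le ht1
  obtain ⟨a, w₀, haμ, habig, hw₀n, hw₀, hxn, hw₀x, hwx⟩ :=
    hC.exists_new_vector hκ htκ htμ hw hwκ hwn
  have hρ := scaleRatio_pos n
  have hρeq := scaleRatio_eq n
  have hρμ : scaleRatio n * scaleRatio n ^ C.s C.μ ≤ scaleRatio n ^ t := scaleRatio_mul_pow_le htμ
  have hint : ∑ k, (a k : ℝ) • C.z k ∈ intLattice n := intLattice_sum _ hC.int a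
  have hdet : coordDet n (Function.update C.z C.μ (∑ k, (a k : ℝ) • C.z k)) = coordDet n C.z := by
    rw [coordDet_update_sum, haμ]; simp
  have hinner : ∀ y : EuclideanSpace ℝ (Fin n), (∀ j, j ≠ C.μ → C.s j < t → ⟪y, C.z j⟫ = 0) →
      ⟪y, ∑ k, (a k : ℝ) • C.z k⟫ = ⟪y, C.z C.μ⟫ := by
    intro y hy
    rw [inner_sum, Finset.sum_eq_single C.μ]
    · rw [real_inner_smul_right, haμ]; simp
    · intro k _ hk
      rw [real_inner_smul_right]
      rcases lt_or_ge (C.s k) t with h | h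
      · rw [hy k hk h, mul_zero]
      · rw [habig k hk h]; simp
    · simp
  generalize (∑ k, (a k : ℝ) • C.z k) = x at *
  set ρ := scaleRatio n with hρdef
  have hR : 0 < ρ ^ t := pow_pos hρ t
  have hwxpos : 0 < ⟪w, x⟫ := lt_of_lt_of_le (by positivity) hwx
  have hwκpos : 0 < ⟪w, C.z κ⟫ := lt_of_lt_of_le (by positivity) hwκ
  -- subtracting a multiple of `w`
  have hcoef : ∀ α : ℝ, ‖(α / ⟪w, x⟫) • w‖ * ρ ^ t ≤ |α| * (6 * 4 ^ n) := by
    intro α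
    rw [norm_smul, Real.norm_eq_abs, abs_div, abs_of_pos hwxpos, div_mul_eq_mul_div,
      div_mul_eq_mul_div, div_le_iff₀ hwxpos]
    calc |α| * ‖w‖ * ρ ^ t ≤ |α| * (3 / 2 * 4 ^ n) * ρ ^ t := by gcongr
      _ = |α| * (6 * 4 ^ n) * (1 / 4 * ρ ^ t) := by ring
      _ ≤ _ := by gcongr
  let d : Fin n → EuclideanSpace ℝ (Fin n) := fun i => C.v i - (⟪C.v i, C.z C.μ⟫ / ⟪w, x⟫) • w
  have hdx : ∀ i, i ≠ C.μ → t < C.s i → ⟪d i, x⟫ = 0 := by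
    intro i hi hti
    rw [inner_sub_left, real_inner_smul_left, div_mul_cancel₀ _ hwxpos.ne',
      hinner _ fun j hj hjt => hC.orth i j hi hj (hjt.trans hti), sub_self]
  have hdz : ∀ i j, j ≠ C.μ → j ≠ κ → ⟪d i, C.z j⟫ = ⟪C.v i, C.z j⟫ := by
    intro i j hj hjκ
    rw [inner_sub_left, real_inner_smul_left, hw j hj hjκ, mul_zero, sub_zero]
  have hdres : ∀ i, i ≠ C.μ → t < C.s i →
      ‖d i‖ + |⟪d i, C.z κ⟫| / (12 * ρ ^ C.s κ) ≤ 3 / 2 := by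
    intro i hi hti
    have hres := hC.reserve i hi (htμ.trans hti)
    set α := ⟪C.v i, C.z C.μ⟫ with hα
    have hc := hcoef α
    have hsκ : 0 < ρ ^ C.s κ := pow_pos hρ _
    have hsμ : 0 < ρ ^ C.s C.μ := pow_pos hρ _
    have h1 : ‖(α / ⟪w, x⟫) • w‖ ≤ |α| * (6 / 256) / ρ ^ C.s C.μ := by
      rw [le_div_iff₀ hsμ]
      have h0 : ‖(α / ⟪w, x⟫) • w‖ * (ρ * ρ ^ C.s C.μ) ≤ |α| * (6 * 4 ^ n) :=
        (mul_le_mul_of_nonneg_left hρμ (norm_nonneg _)).trans hc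
      rw [hρeq] at h0 ⊢
      have h4 : (0 : ℝ) < 4 ^ n := by positivity
      refine le_of_mul_le_mul_right (a := (4 : ℝ) ^ n) ?_ h4
      linarith
    have h2 : ⟪d i, C.z κ⟫ = -⟪(α / ⟪w, x⟫) • w, C.z κ⟫ := by
      rw [inner_sub_left, hC.orth i κ hi hκ (htκ.trans hti), zero_sub]
    have h3 : |⟪d i, C.z κ⟫| / (12 * ρ ^ C.s κ) ≤ 1 / 8 * ‖(α / ⟪w, x⟫) • w‖ := by
      rw [h2, abs_neg, div_le_iff₀ (by positivity)]
      refine (abs_real_inner_le_norm _ _).trans ?_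
      have := mul_le_mul_of_nonneg_left (hC.norm_z κ) (norm_nonneg ((α / ⟪w, x⟫) • w))
      linarith
    have h4 : ‖d i‖ ≤ ‖C.v i‖ + ‖(α / ⟪w, x⟫) • w‖ := norm_sub_le _ _
    have h5 : 9 / 8 * (|α| * (6 / 256) / ρ ^ C.s C.μ) ≤ |α| / (12 * ρ ^ C.s C.μ) := by
      have : 0 ≤ |α| / ρ ^ C.s C.μ := by positivity
      rw [show |α| / (12 * ρ ^ C.s C.μ) = 1 / 12 * (|α| / ρ ^ C.s C.μ) by ring,
        show |α| * (6 / 256) / ρ ^ C.s C.μ = 6 / 256 * (|α| / ρ ^ C.s C.μ) by ring]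
      linarith
    linarith
  let u₀ := C.u - (⟪C.u, C.z C.μ⟫ / ⟪w, x⟫) • w
  have hu₀x : ⟪u₀, x⟫ = 0 := by
    rw [inner_sub_left, real_inner_smul_left, div_mul_cancel₀ _ hwxpos.ne',
      hinner _ fun j hj _ => hC.orth_u j hj, sub_self]
  have hu₀z : ∀ j, j ≠ C.μ → j ≠ κ → ⟪u₀, C.z j⟫ = 0 := by
    intro j hj hjκ
    rw [inner_sub_left, real_inner_smul_left, hw j hj hjκ, mul_zero, sub_zero, hC.orth_u j hj]
  have hu₀ne : u₀ ≠ 0 := by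
    intro h
    have h1 : ⟪u₀, C.z κ⟫ = -(⟪C.u, C.z C.μ⟫ / ⟪w, x⟫) * ⟪w, C.z κ⟫ := by
      rw [inner_sub_left, real_inner_smul_left, hC.orth_u κ hκ]; ring
    rw [h, inner_zero_left] at h1
    have h2 : ⟪C.u, C.z C.μ⟫ / ⟪w, x⟫ = 0 := by
      have := mul_eq_zero.1 h1.symm
      rcases this with h | h
      · linarith
      · exact absurd h hwκpos.ne'
    have h3 : C.u = 0 := by
      have : u₀ = C.u := by simp only [u₀, h2, zero_smul, sub_zero]
      rw [← this, h]
    have := hC.norm_u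
    rw [h3, norm_zero] at this
    norm_num at this
  have hu₀pos : 0 < ‖u₀‖ := norm_pos_iff.2 hu₀ne
  let z' := Function.update C.z C.μ x
  let s' := Function.update C.s C.μ t
  let v' : Fin n → EuclideanSpace ℝ (Fin n) := fun i =>
    if i = C.μ then w₀ else if t < C.s i then d i else C.v i
  let ν' := Function.update C.ν κ (C.ν κ + 1)
  have hzμ : z' C.μ = x := Function.update_self _ _ _
  have hz : ∀ i, i ≠ C.μ → z' i = C.z i := fun i hi => Function.update_of_ne hi _ _
  have hsμ : s' C.μ = t := Function.update_self _ _ _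
  have hs : ∀ i, i ≠ C.μ → s' i = C.s i := fun i hi => Function.update_of_ne hi _ _
  have hvμ : v' C.μ = w₀ := by simp [v']
  have hvd : ∀ i, i ≠ C.μ → t < C.s i → v' i = d i := fun i hi h => by simp [v', hi, h]
  have hvv : ∀ i, i ≠ C.μ → C.s i < t → v' i = C.v i := fun i hi h => by
    simp [v', hi, h.le]
  have hνκ' : ν' κ = C.ν κ + 1 := Function.update_self _ _ _
  have hν' : ∀ i, i ≠ κ → ν' i = C.ν i := fun i hi => Function.update_of_ne hi _ _
  have hcases : ∀ i, i ≠ C.μ → C.s i < t ∨ t < C.s i := fun i hi =>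
    lt_or_gt_of_ne (htfree i hi)
  refine ⟨⟨z', v', s', ν', κ, ‖u₀‖⁻¹ • u₀⟩, ?_, rfl, rfl, ?_⟩
  · constructor
    case int =>
      intro k
      change z' k ∈ _
      rcases eq_or_ne k C.μ with rfl | hk
      · rw [hzμ]; exact hint
      · rw [hz k hk]; exact hC.int k
    case det => rw [← hC.det]; exact congrArg abs hdet
    case inj =>
      intro i j hi hj hij
      change s' i = s' j at hij
      rcases eq_or_ne i C.μ with rfl | hiμ <;> rcases eq_or_ne j C.μ with rfl | hjμ
      · rfl
      · rw [hsμ, hs j hjμ] at hij; exact absurd hij.symm (htfree j hjμ)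
      · rw [hsμ, hs i hiμ] at hij; exact absurd hij (htfree i hiμ)
      · rw [hs i hiμ, hs j hjμ] at hij; exact hC.inj i j hiμ hjμ hij
    case lower =>
      intro k hk
      change ν' k ≤ s' k
      rw [hν' k hk]
      rcases eq_or_ne k C.μ with rfl | hkμ
      · rw [hsμ]; exact ht1
      · rw [hs k hkμ]; exact hC.lower k hkμ
    case upper =>
      intro k hk
      change s' k ≤ ν' k + n
      rw [hν' k hk]
      rcases eq_or_ne k C.μ with rfl | hkμ
      · rw [hsμ]; exact ht2
      · rw [hs k hkμ]; exact hC.upper k hkμ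
    case mover =>
      change s' κ < ν' κ
      rw [hs κ hκ, hνκ', hνκ]; exact Nat.lt_succ_self _
    case norm_z =>
      intro k
      change ‖z' k‖ ≤ 3 / 2 * ρ ^ s' k
      rcases eq_or_ne k C.μ with rfl | hkμ
      · rw [hzμ, hsμ]; exact hxn
      · rw [hz k hkμ, hs k hkμ]; exact hC.norm_z k
    case orth =>
      intro i j hi hj hji
      change ⟪v' i, z' j⟫ = 0
      change s' j < s' i at hji
      have hi : i ≠ κ := hi
      have hj : j ≠ κ := hj
      rcases eq_or_ne i C.μ with rfl | hiμ <;> rcases eq_or_ne j C.μ with rfl | hjμ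
      · exact absurd hji (lt_irrefl _)
      · rw [hsμ, hs j hjμ] at hji
        rw [hvμ, hz j hjμ]; exact hw₀ j hjμ hj hji
      · rw [hsμ, hs i hiμ] at hji
        rw [hvd i hiμ hji, hzμ]; exact hdx i hiμ hji
      · rw [hs i hiμ, hs j hjμ] at hji
        rw [hz j hjμ]
        rcases hcases i hiμ with h | h
        · rw [hvv i hiμ h]; exact hC.orth i j hiμ hjμ hji
        · rw [hvd i hiμ h, hdz i j hjμ hj]; exact hC.orth i j hiμ hjμ hji
    case pair =>
      intro i hi
      change 3 / 4 * ρ ^ s' i ≤ ⟪v' i, z' i⟫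
      have hi : i ≠ κ := hi
      rcases eq_or_ne i C.μ with rfl | hiμ
      · rw [hsμ, hvμ, hzμ]; exact hw₀x
      · rw [hs i hiμ, hz i hiμ]
        rcases hcases i hiμ with h | h
        · rw [hvv i hiμ h]; exact hC.pair i hiμ
        · rw [hvd i hiμ h, hdz i i hiμ hi]; exact hC.pair i hiμ
    case norm_v =>
      intro i hi
      change ‖v' i‖ ≤ 3 / 2
      rcases eq_or_ne i C.μ with rfl | hiμ
      · rw [hvμ, hw₀n]; norm_num
      · rcases hcases i hiμ with h | h
        · rw [hvv i hiμ h]; exact hC.norm_v i hiμ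
        · rw [hvd i hiμ h]
          refine le_trans ?_ (hdres i hiμ h)
          have : 0 ≤ |⟪d i, C.z κ⟫| / (12 * ρ ^ C.s κ) := by positivity
          linarith
    case reserve =>
      intro i hi hsi
      change s' κ < s' i at hsi
      change ‖v' i‖ + |⟪v' i, z' κ⟫| / (12 * ρ ^ s' κ) ≤ 3 / 2
      rw [hs κ hκ] at hsi ⊢
      rw [hz κ hκ]
      rcases eq_or_ne i C.μ with rfl | hiμ
      · rw [hvμ, hw₀n]
        have h1 : |⟪w₀, C.z κ⟫| ≤ 3 / 2 * ρ ^ C.s κ := by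
          refine (abs_real_inner_le_norm _ _).trans ?_
          rw [hw₀n, one_mul]; exact hC.norm_z κ
        have h2 : |⟪w₀, C.z κ⟫| / (12 * ρ ^ C.s κ) ≤ 1 / 8 := by
          rw [div_le_iff₀ (by positivity)]; linarith
        linarith
      · rw [hs i hiμ] at hsi
        rcases hcases i hiμ with h | h
        · rw [hvv i hiμ h, hC.orth i κ hiμ hκ hsi]
          simpa using hC.norm_v i hiμ
        · rw [hvd i hiμ h]; exact hdres i hiμ h
    case norm_u =>
      change ‖‖u₀‖⁻¹ • u₀‖ = 1
      rw [norm_smul, norm_inv, norm_norm, inv_mul_cancel₀ hu₀pos.ne']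
    case orth_u =>
      intro k hk
      change ⟪‖u₀‖⁻¹ • u₀, z' k⟫ = 0
      have hk : k ≠ κ := hk
      rw [real_inner_smul_left]
      rcases eq_or_ne k C.μ with rfl | hkμ
      · rw [hzμ, hu₀x, mul_zero]
      · rw [hz k hkμ, hu₀z k hkμ hk, mul_zero]
  · change ‖‖u₀‖⁻¹ • u₀ - C.u‖ * ρ ^ ∑ k, C.ν k ≤ 12 * 8 ^ n
    have h1 := norm_normalize_sub_le hC.norm_u hu₀ne
    have h2 : ‖u₀ - C.u‖ = ‖(⟪C.u, C.z C.μ⟫ / ⟪w, x⟫) • w‖ := by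
      rw [← norm_neg]; congr 1; simp [u₀]
    have h3 := hcoef ⟪C.u, C.z C.μ⟫
    rw [← h2] at h3
    have h4 := hC.abs_inner_mover_le
    have h5 : ρ ^ C.ν C.μ ≤ ρ ^ t :=
      pow_le_pow_right₀ (by linarith [le_scaleRatio n]) ht1
    have hN : 0 < ρ ^ ∑ k, C.ν k := pow_pos hρ _
    refine le_of_mul_le_mul_right (a := ρ ^ t) ?_ hR
    calc ‖‖u₀‖⁻¹ • u₀ - C.u‖ * (ρ ^ ∑ k, C.ν k) * ρ ^ t
        ≤ 2 * ‖u₀ - C.u‖ * (ρ ^ ∑ k, C.ν k) * ρ ^ t := by gcongr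
      _ = 2 * (‖u₀ - C.u‖ * ρ ^ t) * ρ ^ ∑ k, C.ν k := by ring
      _ ≤ 2 * (|⟪C.u, C.z C.μ⟫| * (6 * 4 ^ n)) * ρ ^ ∑ k, C.ν k := by gcongr
      _ = 12 * 4 ^ n * (|⟪C.u, C.z C.μ⟫| * ρ ^ ∑ k, C.ν k) := by ring
      _ ≤ 12 * 4 ^ n * (2 ^ n * ρ ^ C.ν C.μ) := by gcongr
      _ ≤ 12 * 4 ^ n * (2 ^ n * ρ ^ t) := by gcongr
      _ = 12 * 8 ^ n * ρ ^ t := by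
        rw [show (8 : ℝ) ^ n = 4 ^ n * 2 ^ n by rw [← mul_pow]; norm_num]; ring

end Config.Valid

/-- The configuration `C` realizes the integer heights `a`, and its moving label lies at height at
least that of `r`. -/
def Config.Realizes {n : ℕ} (C : Config n) (a : Fin n → ℕ) (r : Fin n) : Prop :=
  C.Valid ∧ (∃ σ : Equiv.Perm (Fin n), ∀ j, C.ν (σ j) = a j + 1) ∧ a r + 1 ≤ C.ν C.μ

namespace Config

variable {n : ℕ} {C : Config n}

lemma Realizes.sum_eq {a : Fin n → ℕ} {r : Fin n} (hC : C.Realizes a r) :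
    ∑ k, C.ν k = ∑ j, a j + n := by
  obtain ⟨-, ⟨σ, hσ⟩, -⟩ := hC
  rw [← Equiv.sum_comp σ, Finset.sum_congr rfl fun j _ => hσ j]
  simp [Finset.sum_add_distrib]

/-- The target height of the moving label can be raised freely. -/
lemma Valid.raise_mover (hC : C.Valid) :
    Config.Valid { C with ν := Function.update C.ν C.μ (C.ν C.μ + 1) } where
  int := hC.int
  det := hC.det
  inj := hC.inj
  lower k hk := by
    dsimp only; rw [Function.update_of_ne (show k ≠ C.μ from hk)]; exact hC.lower k hk
  upper k hk := by
    dsimp only; rw [Function.update_of_ne (show k ≠ C.μ from hk)]; exact hC.upper k hk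
  mover := by
    dsimp only; rw [Function.update_self]; exact hC.mover.trans (Nat.lt_succ_self _)
  norm_z := hC.norm_z
  orth := hC.orth
  pair := hC.pair
  norm_v := hC.norm_v
  reserve := hC.reserve
  norm_u := hC.norm_u
  orth_u := hC.orth_u

/-- The target height of another label can be raised as long as it is below its scale. -/
lemma Valid.raise_of_lt (hC : C.Valid) {κ : Fin n} (hκ : κ ≠ C.μ) (hlt : C.ν κ < C.s κ) :
    Config.Valid { C with ν := Function.update C.ν κ (C.ν κ + 1) } where
  int := hC.int
  det := hC.det
  inj := hC.inj
  lower k hk := by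
    rcases eq_or_ne k κ with rfl | h
    · dsimp only; rw [Function.update_self]; exact hlt
    · dsimp only; rw [Function.update_of_ne h]; exact hC.lower k hk
  upper k hk := by
    have := hC.upper k hk
    rcases eq_or_ne k κ with rfl | h
    · dsimp only; rw [Function.update_self]; omega
    · dsimp only; rw [Function.update_of_ne h]; exact this
  mover := by
    dsimp only; rw [Function.update_of_ne hκ.symm]; exact hC.mover
  norm_z := hC.norm_z
  orth := hC.orth
  pair := hC.pair
  norm_v := hC.norm_v
  reserve := hC.reserve
  norm_u := hC.norm_u
  orth_u := hC.orth_u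

/-- A configuration realizing the heights `a` can be moved to one realizing the next heights,
at a small cost in the direction `u`. -/
lemma Realizes.exists_next {a : Fin n → ℕ} {r r' : Fin n} (hC : C.Realizes a r)
    (hr : Function.update a r (a r + 1) r' ≤ Function.update a r (a r + 1) r) :
    ∃ C' : Config n, C'.Realizes (Function.update a r (a r + 1)) r' ∧
      ‖C'.u - C.u‖ * scaleRatio n ^ ∑ k, C.ν k ≤ 12 * 8 ^ n := by
  obtain ⟨hV, ⟨σ, hσ⟩, hμ⟩ := hC
  rw [Function.update_self] at hr
  have hupd : ∀ τ : Equiv.Perm (Fin n), (∀ j, C.ν (τ j) = a j + 1) →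
      ∀ j, Function.update C.ν (τ r) (C.ν (τ r) + 1) (τ j) =
        Function.update a r (a r + 1) j + 1 := by
    intro τ hτ j
    rcases eq_or_ne j r with rfl | h
    · rw [Function.update_self, Function.update_self, hτ]
    · rw [Function.update_of_ne (τ.injective.ne h), Function.update_of_ne h, hτ]
  rcases hμ.eq_or_lt with heq | hlt
  · have hτ : ∀ j, C.ν ((Equiv.swap (σ r) C.μ) (σ j)) = a j + 1 := by
      intro j
      rw [← hσ j, Equiv.swap_apply_def]
      split_ifs with h1 h2
      · rw [h1, hσ r, heq]
      · rw [h2, hσ r, heq]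
      · rfl
    have h := hupd (σ.trans (Equiv.swap (σ r) C.μ)) hτ
    have hr0 : (σ.trans (Equiv.swap (σ r) C.μ)) r = C.μ := by simp
    rw [hr0] at h
    refine ⟨_, ⟨hV.raise_mover, ⟨_, h⟩, ?_⟩, by simp⟩
    simp only [Function.update_self]
    omega
  · have hne : σ r ≠ C.μ := by
      intro h
      rw [← h, hσ r] at hlt
      exact lt_irrefl _ hlt
    have hlow := hV.lower _ hne
    rcases hlow.eq_or_lt with he | hl
    · have hsr : C.s (σ r) < C.ν C.μ := by rw [← he, hσ r]; exact hlt
      obtain ⟨C', hV', hν, hμ', hu⟩ := hV.exists_switch hne hsr he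
      refine ⟨C', ⟨hV', ⟨σ, by rw [hν]; exact hupd σ hσ⟩, ?_⟩, hu⟩
      rw [hν, hμ', Function.update_self, hσ r]
      omega
    · refine ⟨_, ⟨hV.raise_of_lt hne hl, ⟨σ, hupd σ hσ⟩, ?_⟩, by simp⟩
      simp only [Function.update_of_ne hne.symm]
      omega

end Config

lemma exists_unit_orthogonal {m : ℕ} (w : Fin m → EuclideanSpace ℝ (Fin (m + 1))) :
    ∃ u : EuclideanSpace ℝ (Fin (m + 1)), ‖u‖ = 1 ∧ ∀ k, ⟪u, w k⟫ = 0 := by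
  have hne : (Submodule.span ℝ (Set.range w))ᗮ ≠ ⊥ := by
    rw [Ne, Submodule.orthogonal_eq_bot_iff]
    intro h
    have h1 := finrank_range_le_card (R := ℝ) w
    rw [Set.finrank, h, finrank_top, finrank_euclideanSpace_fin, Fintype.card_fin] at h1
    omega
  obtain ⟨x, hx, hx0⟩ := Submodule.exists_mem_ne_zero_of_ne_bot hne
  refine ⟨‖x‖⁻¹ • x, ?_, fun k => ?_⟩
  · rw [norm_smul, norm_inv, norm_norm, inv_mul_cancel₀ (norm_ne_zero_iff.2 hx0)]
  · rw [real_inner_smul_left, real_inner_comm,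
      hx _ (Submodule.subset_span (Set.mem_range_self k)), mul_zero]

/-- Every monotone family of heights can be realized. -/
lemma exists_realizes {n : ℕ} {a : Fin n → ℕ} (ha : Monotone a) (r : Fin n) :
    ∃ C : Config n, C.Realizes a r := by
  obtain _ | m := n
  · exact r.elim0
  set σ : Equiv.Perm (Fin (m + 1)) :=
    (finSuccEquiv' r).trans (finSuccEquiv' (Fin.last m)).symm with hσ
  have hσl : σ.symm (Fin.last m) = r := by simp [hσ]
  have hσc : ∀ k : Fin m, σ.symm k.castSucc = r.succAbove k := by
    intro k
    rw [hσ, Equiv.symm_trans_apply, Equiv.symm_symm, ← Fin.succAbove_last_apply,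
      finSuccEquiv'_succAbove, finSuccEquiv'_symm_some]
  set ρ := scaleRatio (m + 1) with hρd
  have hρ : 256 ≤ ρ := le_scaleRatio _
  let e : Fin (m + 1) → EuclideanSpace ℝ (Fin (m + 1)) := fun i => EuclideanSpace.single i 1
  have hee : ∀ i j, ⟪e i, e j⟫ = if i = j then (1 : ℝ) else 0 := by
    intro i j; simp [e, EuclideanSpace.inner_single_left]
  have hen : ∀ i, ‖e i‖ = 1 := by intro i; simp [e]
  let ν : Fin (m + 1) → ℕ := fun l => a (σ.symm l) + 1
  let t : Fin m → ℕ := fun k => ν k.castSucc + k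
  have ht : StrictMono t := by
    intro i j hij
    have h1 : ν i.castSucc ≤ ν j.castSucc := by
      simp only [ν, hσc]
      exact Nat.succ_le_succ (ha (r.strictMono_succAbove.monotone hij.le))
    have h2 : (i : ℕ) < j := hij
    simp only [t]; omega
  let w : Fin m → EuclideanSpace ℝ (Fin (m + 1)) := fun k =>
    e k.castSucc + ρ ^ t k • e k.succ
  obtain ⟨u, hu, huw⟩ := exists_unit_orthogonal w
  let C : Config (m + 1) :=
    { z := Fin.snoc (α := fun _ => EuclideanSpace ℝ (Fin (m + 1))) w (e (Fin.last m))
      v := Fin.snoc (α := fun _ => EuclideanSpace ℝ (Fin (m + 1))) (fun k => e k.succ) 0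
      s := Fin.snoc (α := fun _ => ℕ) t 0
      ν := ν
      μ := Fin.last m
      u := u }
  have hcases : ∀ k, k ≠ C.μ → ∃ l : Fin m, k = l.castSucc := by
    intro k hk
    exact ⟨k.castPred hk, by simp⟩
  have hzc : ∀ k : Fin m, C.z k.castSucc = w k := fun k => by simp [C]
  have hvc : ∀ k : Fin m, C.v k.castSucc = e k.succ := fun k => by simp [C]
  have hsc : ∀ k : Fin m, C.s k.castSucc = t k := fun k => by simp [C]
  have hzl : C.z (Fin.last m) = e (Fin.last m) := by simp [C]
  have hsl : C.s (Fin.last m) = 0 := by simp [C]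
  have hin : ∀ i k : Fin m, ⟪e i.succ, w k⟫ =
      (if i.succ = k.castSucc then 1 else 0) + ρ ^ t k * (if i = k then 1 else 0) := by
    intro i k
    simp only [w, inner_add_right, real_inner_smul_right, hee, Fin.succ_inj]
  refine ⟨C, ⟨?_, ⟨σ, fun j => by simp [C, ν]⟩, ?_⟩⟩
  · constructor
    case int =>
      intro k
      have hint : ∀ i, e i ∈ intLattice (m + 1) := fun i j =>
        ⟨if j = i then 1 else 0, by simp [e]⟩
      refine Fin.lastCases ?_ (fun k => ?_) k
      · rw [hzl]; exact hint _
      · rw [hzc]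
        intro j
        obtain ⟨x, hx⟩ := hint k.castSucc j
        obtain ⟨y, hy⟩ := hint k.succ j
        refine ⟨x + ((2 : ℤ) ^ (2 * (m + 1) + 8)) ^ t k * y, ?_⟩
        simp [w, hx, hy, hρd, scaleRatio]
    case det =>
      rw [coordDet_apply, Matrix.det_of_isLowerTriangular]
      · rw [Finset.prod_eq_one, abs_one]
        intro k _
        rw [Matrix.of_apply]
        refine Fin.lastCases ?_ (fun k => ?_) k
        · rw [hzl]; simp [e]
        · rw [hzc]; simp [w, e, k.castSucc_lt_succ.ne]
      · intro i j hij
        have hij : i < j := hij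
        rw [Matrix.of_apply]
        revert hij
        refine Fin.lastCases (fun h => ?_) (fun k h => ?_) j
        · rw [hzl]; simp [e, h.ne]
        · rw [hzc]
          simp [w, e, h.ne, (h.trans k.castSucc_lt_succ).ne]
    case inj =>
      intro i j hi hj h
      obtain ⟨i, rfl⟩ := hcases i hi
      obtain ⟨j, rfl⟩ := hcases j hj
      rw [hsc, hsc] at h
      rw [ht.injective h]
    case lower =>
      intro k hk
      obtain ⟨k, rfl⟩ := hcases k hk
      rw [hsc]; exact Nat.le_add_right _ _
    case upper =>
      intro k hk
      obtain ⟨k, rfl⟩ := hcases k hk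
      rw [hsc]
      have := k.2
      simp only [t, C]; omega
    case mover =>
      change C.s (Fin.last m) < ν (Fin.last m)
      rw [hsl]; exact Nat.succ_pos _
    case norm_z =>
      intro k
      refine Fin.lastCases ?_ (fun k => ?_) k
      · rw [hzl, hsl, hen]; norm_num
      · rw [hzc, hsc]
        have h1 : ‖w k‖ ≤ 1 + ρ ^ t k := by
          refine (norm_add_le _ _).trans ?_
          rw [norm_smul, hen, hen, mul_one, Real.norm_of_nonneg (by positivity)]
        have h2 : ρ ≤ ρ ^ t k := le_self_pow₀ (by linarith) (by simp only [t, ν]; omega)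
        linarith
    case orth =>
      intro i j hi hj h
      obtain ⟨i, rfl⟩ := hcases i hi
      obtain ⟨j, rfl⟩ := hcases j hj
      rw [hsc, hsc, ht.lt_iff_lt] at h
      have h1 : i.succ ≠ j.castSucc := fun hc =>
        absurd (congrArg Fin.val hc) (by simp only [Fin.val_succ, Fin.val_castSucc]; omega)
      rw [hvc, hzc, hin, if_neg h1, if_neg h.ne']; simp
    case pair =>
      intro i hi
      obtain ⟨i, rfl⟩ := hcases i hi
      rw [hsc, hvc, hzc, hin, if_neg i.castSucc_lt_succ.ne', if_pos rfl]
      have : 0 < ρ ^ t i := by positivity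
      linarith
    case norm_v =>
      intro i hi
      obtain ⟨i, rfl⟩ := hcases i hi
      rw [hvc, hen]; norm_num
    case reserve =>
      intro i hi _
      obtain ⟨i, rfl⟩ := hcases i hi
      change ‖C.v i.castSucc‖ + |⟪C.v i.castSucc, C.z (Fin.last m)⟫| /
        (12 * ρ ^ C.s (Fin.last m)) ≤ 3 / 2
      rw [hvc, hen, hzl, hsl, hee]
      split_ifs <;> norm_num
    case norm_u => exact hu
    case orth_u =>
      intro k hk
      obtain ⟨k, rfl⟩ := hcases k hk
      rw [hzc]; exact huw k
  · change a r + 1 ≤ a (σ.symm (Fin.last m)) + 1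
    rw [hσl]

namespace Config

variable {n : ℕ} {C : Config n}

lemma Valid.norm_z_le (hC : C.Valid) (k : Fin n) :
    ‖C.z k‖ ≤ 3 / 2 * scaleRatio n ^ (C.ν k + n) := by
  refine (hC.norm_z k).trans ?_
  have hs : C.s k ≤ C.ν k + n := by
    rcases eq_or_ne k C.μ with rfl | h
    · have := hC.mover
      omega
    · exact hC.upper k h
  exact mul_le_mul_of_nonneg_left
    (pow_le_pow_right₀ (by linarith [le_scaleRatio n]) hs) (by norm_num)

/-- All vectors of a configuration are nearly orthogonal to any direction close to `u`. -/
lemma Valid.abs_inner_le (hC : C.Valid) {w : EuclideanSpace ℝ (Fin n)}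
    (hw : ‖w - C.u‖ * scaleRatio n ^ ∑ k, C.ν k ≤ 24 * 8 ^ n) (k : Fin n) :
    |⟪C.z k, w⟫| * scaleRatio n ^ ∑ k, C.ν k ≤ 37 * 8 ^ n * scaleRatio n ^ (C.ν k + n) := by
  have hρ := scaleRatio_pos n
  set ρ := scaleRatio n
  have hN : 0 < ρ ^ ∑ k, C.ν k := pow_pos hρ _
  have h1 : |⟪C.z k, w⟫| ≤ |⟪C.u, C.z k⟫| + ‖C.z k‖ * ‖w - C.u‖ := by
    have : ⟪C.z k, w⟫ = ⟪C.u, C.z k⟫ + ⟪C.z k, w - C.u⟫ := by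
      rw [inner_sub_right, real_inner_comm (C.z k) C.u]; ring
    rw [this]
    exact (abs_add_le _ _).trans (add_le_add_right (abs_real_inner_le_norm _ _) _)
  have h2 : |⟪C.u, C.z k⟫| * ρ ^ ∑ k, C.ν k ≤ 8 ^ n * ρ ^ (C.ν k + n) := by
    rcases eq_or_ne k C.μ with rfl | h
    · refine hC.abs_inner_mover_le.trans ?_
      have : 1 ≤ ρ := by linarith [le_scaleRatio n]
      gcongr
      · norm_num
      · omega
    · rw [hC.orth_u k h, abs_zero, zero_mul]
      positivity
  calc |⟪C.z k, w⟫| * ρ ^ ∑ k, C.ν k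
      ≤ (|⟪C.u, C.z k⟫| + ‖C.z k‖ * ‖w - C.u‖) * ρ ^ ∑ k, C.ν k := by gcongr
    _ = |⟪C.u, C.z k⟫| * (ρ ^ ∑ k, C.ν k) + ‖C.z k‖ * (‖w - C.u‖ * ρ ^ ∑ k, C.ν k) := by ring
    _ ≤ 8 ^ n * ρ ^ (C.ν k + n) + 3 / 2 * ρ ^ (C.ν k + n) * (24 * 8 ^ n) :=
        add_le_add h2 (mul_le_mul (hC.norm_z_le k) hw (by positivity) (by positivity))
    _ = 37 * 8 ^ n * ρ ^ (C.ν k + n) := by ring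

end Config

section Limit

variable {n : ℕ} {A : ℕ → Fin n → ℕ} {r : ℕ → Fin n}

lemma exists_config_sequence (hA0 : Monotone (A 0))
    (hA : ∀ i, A (i + 1) = Function.update (A i) (r i) (A i (r i) + 1))
    (hr : ∀ i, A (i + 1) (r (i + 1)) ≤ A (i + 1) (r i)) :
    ∃ C : ℕ → Config n, (∀ i, (C i).Realizes (A i) (r i)) ∧
      ∀ i, ‖(C (i + 1)).u - (C i).u‖ * scaleRatio n ^ ∑ k, (C i).ν k ≤ 12 * 8 ^ n := by
  obtain ⟨C₀, hC₀⟩ := exists_realizes hA0 (r 0)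
  have step : ∀ (i : ℕ) (C : {C : Config n // C.Realizes (A i) (r i)}),
      ∃ C' : {C : Config n // C.Realizes (A (i + 1)) (r (i + 1))},
        ‖C'.1.u - C.1.u‖ * scaleRatio n ^ ∑ k, C.1.ν k ≤ 12 * 8 ^ n := by
    rintro i ⟨C, hC⟩
    have h := hr i
    rw [hA i] at h
    obtain ⟨C', hC', hu⟩ := hC.exists_next h
    rw [← hA i] at hC'
    exact ⟨⟨C', hC'⟩, hu⟩
  choose f hf using step
  let S : ∀ i, {C : Config n // C.Realizes (A i) (r i)} := fun i =>
    Nat.rec ⟨C₀, hC₀⟩ (fun i C => f i C) i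
  exact ⟨fun i => (S i).1, fun i => (S i).2, fun i => hf i (S i)⟩

/-- The directions of a sequence of configurations converge, with a quantitative rate. -/
lemma exists_limit_direction
    (hA : ∀ i, A (i + 1) = Function.update (A i) (r i) (A i (r i) + 1))
    {C : ℕ → Config n} (hC : ∀ i, (C i).Realizes (A i) (r i))
    (hu : ∀ i, ‖(C (i + 1)).u - (C i).u‖ * scaleRatio n ^ ∑ k, (C i).ν k ≤ 12 * 8 ^ n) :
    ∃ w : EuclideanSpace ℝ (Fin n), ‖w‖ = 1 ∧
      ∀ i, ‖w - (C i).u‖ * scaleRatio n ^ ∑ k, (C i).ν k ≤ 24 * 8 ^ n := by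
  have hρ := scaleRatio_pos n
  have hρ2 := le_scaleRatio n
  set ρ := scaleRatio n
  have hsucc : ∀ i, ∑ k, (C (i + 1)).ν k = ∑ k, (C i).ν k + 1 := by
    intro i
    rw [(hC (i + 1)).sum_eq, (hC i).sum_eq, hA i, Finset.sum_update_of_mem (mem_univ _),
      ← Finset.add_sum_erase _ (A i) (mem_univ (r i)), Finset.sdiff_singleton_eq_erase]
    ring
  have hN : ∀ i, ∑ k, (C i).ν k = ∑ k, (C 0).ν k + i := by
    intro i
    induction i with
    | zero => rfl
    | succ i ih => rw [hsucc, ih, add_assoc]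
  set K : ℝ := 12 * 8 ^ n / ρ ^ ∑ k, (C 0).ν k
  have hdist : ∀ i, dist (C i).u (C (i + 1)).u ≤ K * (ρ⁻¹) ^ i := by
    intro i
    have h := hu i
    rw [hN i, ← le_div_iff₀ (pow_pos hρ _)] at h
    rw [dist_comm, dist_eq_norm]
    refine h.trans_eq ?_
    rw [pow_add, inv_pow, div_mul_eq_div_div, div_eq_mul_inv _ (ρ ^ i)]
  have hinv : ρ⁻¹ ≤ 1 / 2 := by
    rw [inv_eq_one_div]; exact one_div_le_one_div_of_le (by norm_num) (by linarith)
  have hlt : ρ⁻¹ < 1 := by linarith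
  obtain ⟨w, hw⟩ := cauchySeq_tendsto_of_complete (cauchySeq_of_le_geometric _ _ hlt hdist)
  refine ⟨w, ?_, fun i => ?_⟩
  · refine tendsto_nhds_unique hw.norm ?_
    simp only [(hC _).1.norm_u]
    exact tendsto_const_nhds
  · have h := dist_le_of_le_geometric_of_tendsto _ _ hlt hdist hw i
    rw [dist_comm, dist_eq_norm] at h
    have hNi : 0 < ρ ^ ∑ k, (C i).ν k := pow_pos hρ _
    have hK : K * ρ⁻¹ ^ i * ρ ^ ∑ k, (C i).ν k = 12 * 8 ^ n := by
      rw [hN i, pow_add, inv_pow]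
      simp only [K]
      field_simp
    have h2 : ‖w - (C i).u‖ * (1 - ρ⁻¹) ≤ K * ρ⁻¹ ^ i := (le_div_iff₀ (by linarith)).1 h
    have h3 := mul_le_mul_of_nonneg_right h2 hNi.le
    rw [hK] at h3
    have h4 : 0 ≤ ‖w - (C i).u‖ * ρ ^ ∑ k, (C i).ν k := by positivity
    nlinarith

end Limit

/-- The constant lost when the vectors of a configuration are compared with the system. -/
lemma error_constant_le {n : ℕ} (hn : 2 ≤ n) :
    ((n : ℝ) - 1) * ((2 * n ^ 2 + 13 * n + 14) * Real.log 2) + Real.log n ≤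
      3 * n ^ 2 * (n + 9) := by
  have hn' : (2 : ℝ) ≤ n := by exact_mod_cast hn
  have h1 : Real.log n ≤ n := (Real.log_le_sub_one_of_pos (by linarith)).trans (by linarith)
  have h2 : Real.log 2 ≤ 1 := by linarith [Real.log_two_lt_d9]
  have h3 : 0 ≤ ((n : ℝ) - 1) * (2 * n ^ 2 + 13 * n + 14) :=
    mul_nonneg (by linarith) (by positivity)
  have h4 := mul_le_mul_of_nonneg_left h2 h3
  nlinarith [pow_pos (show (0 : ℝ) < n by linarith) 3]

/-- Let `n ≥ 2`, `q₀ ≥ 0`, and let `P` be an `(n,0)`-system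
on `[q₀,∞)`.  Then there is a unit vector `u ∈ ℝⁿ` such that
`‖P(q) − L_u(q)‖_∞ ≤ 3n²(n+9)` for all `q ≥ q₀`, where
`L_u(q) = (log λ₁(C_u(e^q)), …, log λ_n(C_u(e^q)))` with successive minima
taken with respect to `ℤⁿ`. -/
theorem stmt19 (n : ℕ) (hn : 2 ≤ n) (q₀ : ℝ) (hq₀ : 0 ≤ q₀)
    (P : ℝ → Fin n → ℝ) (hP : IsNSystem n 0 q₀ P) :
    ∃ u : EuclideanSpace ℝ (Fin n), ‖u‖ = 1 ∧
      ∀ q : ℝ, q₀ ≤ q → ∀ j : Fin n,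
        |P q j - Real.log (minkMin (intLattice n) (bodyC u (Real.exp q)) ((j : ℕ) + 1))|
          ≤ 3 * n ^ 2 * (n + 9) := by
  set δ : ℝ := (2 * n + 8) * Real.log 2 with hδ
  have hlog2 : 0 < Real.log 2 := Real.log_pos (by norm_num)
  have hδ0 : 0 < δ := by positivity
  have hpow : ∀ k : ℕ, scaleRatio n ^ k = Real.exp (δ * k) := by
    intro k
    rw [mul_comm δ, Real.exp_nat_mul]
    congr 1
    rw [hδ, scaleRatio, ← Real.rpow_natCast, Real.rpow_def_of_pos (by norm_num)]
    push_cast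
    ring_nf
  have h8 : ∀ a : ℝ, a ≤ 64 → a * 8 ^ n ≤ Real.exp ((3 * n + 6) * Real.log 2) := by
    intro a ha
    have : Real.exp ((3 * n + 6) * Real.log 2) = 64 * 8 ^ n := by
      rw [mul_comm, ← Real.rpow_def_of_pos (by norm_num),
        show (3 * n + 6 : ℝ) = ((3 * n + 6 : ℕ) : ℝ) by push_cast; ring, Real.rpow_natCast,
        pow_add, pow_mul]
      norm_num
      ring
    rw [this]
    gcongr
  obtain ⟨A, r, hA0, hA, hr, hcell⟩ := hP.exists_event_sequence hδ0
  obtain ⟨C, hC, hCu⟩ := exists_config_sequence hA0 hA hr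
  obtain ⟨w, hw1, hw⟩ := exists_limit_direction hA hC hCu
  refine ⟨w, hw1, fun q hq j => ?_⟩
  obtain ⟨i, hi⟩ := hcell q hq
  have hNsum := (hC i).sum_eq
  obtain ⟨hV, ⟨σ, hσ⟩, -⟩ := hC i
  have hsum := hP.sum_eq hq
  have hqN : q ≤ δ * ∑ k, (C i).ν k := by
    rw [hNsum, ← hsum]
    refine (Finset.sum_le_sum fun j _ => (hi j).2.le).trans_eq ?_
    push_cast
    simp [← Finset.mul_sum, Finset.sum_add_distrib]
  refine (abs_sub_log_minkMin_le hn hw1 (c := (2 * n ^ 2 + 13 * n + 14) * Real.log 2)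
    (by positivity) (hP.sorted hq) hsum (z := fun j => (C i).z (σ j)) (fun j => hV.int _)
    ?_ (fun j => ?_) (fun j => ?_) j).trans (error_constant_le hn)
  · have h : coordDet n (fun j => (C i).z (σ j)) = _ := (coordDet n).map_perm (C i).z σ
    rw [h]
    have h1 : coordDet n (C i).z ≠ 0 := by
      intro h0
      have := hV.det
      rw [h0, abs_zero] at this
      exact zero_ne_one this
    rcases Int.units_eq_one_or (Equiv.Perm.sign σ) with h | h <;> simp [h, h1]
  · have h1 := hV.norm_z_le (σ j)
    rw [hσ, hpow] at h1
    refine h1.trans ?_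
    have h2 : (3 / 2 : ℝ) ≤ Real.exp ((3 * n + 6) * Real.log 2) := by
      refine le_trans ?_ (h8 (3 / 2) (by norm_num))
      have : (1 : ℝ) ≤ 8 ^ n := one_le_pow₀ (by norm_num)
      linarith
    refine (mul_le_mul_of_nonneg_right h2 (Real.exp_pos _).le).trans ?_
    rw [← Real.exp_add, Real.exp_le_exp]
    have h3 := (hi j).1
    push_cast
    rw [hδ] at h3 ⊢
    linarith
  · have h1 := hV.abs_inner_le (hw i) (σ j)
    rw [hσ, hpow, hpow] at h1
    have h2 := h1.trans (mul_le_mul_of_nonneg_right (h8 37 (by norm_num)) (Real.exp_pos _).le)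
    rw [← Real.exp_add, ← le_div_iff₀ (Real.exp_pos _), ← Real.exp_sub] at h2
    refine h2.trans ?_
    rw [Real.exp_le_exp]
    have h3 := (hi j).1
    have h4 : δ * ((A i j + 1 + n : ℕ) : ℝ) = δ * A i j + (2 * n + 8) * Real.log 2 * (n + 1) := by
      rw [← hδ]; push_cast; ring
    linarith
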